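/- As p → +∞ one has: ‖u_p⁻‖_∞ → (√e/t̄)·e^{t̄/(2(t̄+√e))} (≈ 2.46), ‖u_p⁺‖_∞ → e^{t̄/(2(t̄+√e))} (≈ 1.17), and p·∫_B |∇u_p|² dx → 8π·e^{t̄/(t̄+√e)}·(e/t̄² + 1 + 2√e/t̄) (≈ 332). -/

import Mathlib

open Real MeasureTheory Set Filter

noncomputable section

/-- The radial energy functional for the Lane–Emden problem on the unit ball of `ℝ²`
(written in polar coordinates; the common factor `2π` is dropped). -/
def radialEnergy (p : ℝ) (v : ℝ → ℝ) : ℝ :=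
  (1 / 2) * (∫ r in (0:ℝ)..1, (deriv v r) ^ 2 * r)
    - (1 / (p + 1)) * ∫ r in (0:ℝ)..1, |v r| ^ (p + 1) * r

/-- The Nehari identity `∫_B |∇v⁺|² = ∫_B |v⁺|^{p+1}` for the positive part,
written in polar coordinates. -/
def nehariPos (p : ℝ) (v : ℝ → ℝ) : Prop :=
  (∫ r in (0:ℝ)..1, (if 0 < v r then (deriv v r) ^ 2 * r else 0))
    = ∫ r in (0:ℝ)..1, (max (v r) 0) ^ (p + 1) * r

/-- The Nehari identity `∫_B |∇v⁻|² = ∫_B |v⁻|^{p+1}` for the negative part,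
written in polar coordinates. -/
def nehariNeg (p : ℝ) (v : ℝ → ℝ) : Prop :=
  (∫ r in (0:ℝ)..1, (if v r < 0 then (deriv v r) ^ 2 * r else 0))
    = ∫ r in (0:ℝ)..1, (max (-v r) 0) ^ (p + 1) * r

/-- A family `p ↦ u p` (for `p > 1`) of least energy nodal radial solutions of the
Lane–Emden problem `−Δu = |u|^{p−1}u` in the unit ball `B ⊆ ℝ²`, `u = 0` on `∂B`,
described through the radial profile `u p : ℝ → ℝ`.  `rp p ∈ (0,1)` is the nodal
radius, `sp p ∈ (rp p, 1)` is a radius where `u p` attains `‖(u p)⁺‖_∞`; the solution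
is negative in the inner nodal region (`u p 0 < 0`), attains `-‖(u p)⁻‖_∞` at `0`,
and minimizes the energy among radial members of the nodal Nehari set. -/
structure LaneEmdenFamily where
  u : ℝ → ℝ → ℝ
  rp : ℝ → ℝ
  sp : ℝ → ℝ
  smooth : ∀ p, 1 < p → ContDiffOn ℝ 2 (u p) (Icc (0:ℝ) 1)
  ode : ∀ p, 1 < p → ∀ r ∈ Ioo (0:ℝ) 1,
    -deriv (deriv (u p)) r - deriv (u p) r / r = |u p r| ^ (p - 1) * u p r
  derivAtZero : ∀ p, 1 < p → deriv (u p) 0 = 0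
  boundary : ∀ p, 1 < p → u p 1 = 0
  center_neg : ∀ p, 1 < p → u p 0 < 0
  min_at_zero : ∀ p, 1 < p → ∀ r ∈ Icc (0:ℝ) 1, u p 0 ≤ u p r
  rp_mem : ∀ p, 1 < p → rp p ∈ Ioo (0:ℝ) 1
  rp_zero : ∀ p, 1 < p → u p (rp p) = 0
  neg_in : ∀ p, 1 < p → ∀ r ∈ Ico (0:ℝ) (rp p), u p r < 0
  pos_out : ∀ p, 1 < p → ∀ r ∈ Ioo (rp p) 1, 0 < u p r
  sp_mem : ∀ p, 1 < p → sp p ∈ Ioo (rp p) 1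
  sp_max : ∀ p, 1 < p → ∀ r ∈ Icc (0:ℝ) 1, u p r ≤ u p (sp p)
  least_energy : ∀ p, 1 < p → ∀ v : ℝ → ℝ,
    ContDiffOn ℝ 1 v (Icc (0:ℝ) 1) → v 1 = 0 →
    (∃ r ∈ Ioo (0:ℝ) 1, 0 < v r) → (∃ r ∈ Ioo (0:ℝ) 1, v r < 0) →
    nehariPos p v → nehariNeg p v →
    radialEnergy p (u p) ≤ radialEnergy p v

/-- `ε_p⁺`, defined by `(ε_p⁺)⁻² = p · ‖u_p⁺‖_∞^{p−1} = p · u_p(s_p)^{p−1}`. -/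
def epsP (F : LaneEmdenFamily) (p : ℝ) : ℝ :=
  1 / Real.sqrt (p * F.u p (F.sp p) ^ (p - 1))

/-- `ε_p⁻`, defined by `(ε_p⁻)⁻² = p · ‖u_p⁻‖_∞^{p−1} = p · |u_p(0)|^{p−1}`. -/
def epsM (F : LaneEmdenFamily) (p : ℝ) : ℝ :=
  1 / Real.sqrt (p * (-F.u p 0) ^ (p - 1))

/-! ### Monotonicity from the sign of the derivative -/

theorem le_of_hasDerivAt_nonpos {F F' : ℝ → ℝ} {a b : ℝ} (hab : a ≤ b)
    (hc : ContinuousOn F (Icc a b)) (hd : ∀ s ∈ Ioo a b, HasDerivAt F (F' s) s)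
    (h : ∀ s ∈ Ioo a b, F' s ≤ 0) : F b ≤ F a := by
  have hm : AntitoneOn F (Icc a b) := by
    refine antitoneOn_of_hasDerivWithinAt_nonpos (f' := F') (convex_Icc a b) hc ?_ ?_
    · intro x hx
      rw [interior_Icc] at hx
      exact (hd x hx).hasDerivWithinAt
    · intro x hx
      rw [interior_Icc] at hx
      exact h x hx
  exact hm (left_mem_Icc.2 hab) (right_mem_Icc.2 hab) hab

theorem le_of_hasDerivAt_nonneg {F F' : ℝ → ℝ} {a b : ℝ} (hab : a ≤ b)
    (hc : ContinuousOn F (Icc a b)) (hd : ∀ s ∈ Ioo a b, HasDerivAt F (F' s) s)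
    (h : ∀ s ∈ Ioo a b, 0 ≤ F' s) : F a ≤ F b := by
  have := le_of_hasDerivAt_nonpos (F := fun s => -F s) (F' := fun s => -F' s) hab hc.neg
    (fun s hs => (hd s hs).neg) (fun s hs => neg_nonpos.2 (h s hs))
  linarith

theorem le_of_tendsto_atBot_of_hasDerivAt_nonpos {F F' : ℝ → ℝ} {b l : ℝ}
    (hc : ContinuousOn F (Iic b)) (hd : ∀ s < b, HasDerivAt F (F' s) s)
    (h : ∀ s < b, F' s ≤ 0) (hl : Tendsto F atBot (nhds l)) {s : ℝ} (hs : s ≤ b) : F s ≤ l := by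
  refine ge_of_tendsto hl ?_
  filter_upwards [eventually_le_atBot s] with x hx
  exact le_of_hasDerivAt_nonpos hx (hc.mono fun y hy => hy.2.trans hs)
    (fun y hy => hd y (hy.2.trans_le hs)) (fun y hy => h y (hy.2.trans_le hs))

theorem ge_of_tendsto_atBot_of_hasDerivAt_nonneg {F F' : ℝ → ℝ} {b l : ℝ}
    (hc : ContinuousOn F (Iic b)) (hd : ∀ s < b, HasDerivAt F (F' s) s)
    (h : ∀ s < b, 0 ≤ F' s) (hl : Tendsto F atBot (nhds l)) {s : ℝ} (hs : s ≤ b) : l ≤ F s := by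
  have := le_of_tendsto_atBot_of_hasDerivAt_nonpos (F := fun s => -F s) (F' := fun s => -F' s)
    hc.neg (fun s hs => (hd s hs).neg) (fun s hs => neg_nonpos.2 (h s hs)) hl.neg hs
  linarith

/-! ### The nonlinearity in logarithmic radial coordinates -/

/-- The right-hand side of the Lane–Emden equation in the variable `s = log r + const`,
for a solution of height comparable to `p`. -/
def force (p s x : ℝ) : ℝ := Real.exp (2 * s) * (x / p) ^ p

theorem force_nonneg {p s x : ℝ} (hp : 0 < p) (hx : 0 ≤ x) : 0 ≤ force p s x :=
  mul_nonneg (Real.exp_pos _).le (Real.rpow_nonneg (div_nonneg hx hp.le) _)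

theorem force_le_exp {p s x : ℝ} (hp : 0 < p) (hx : 0 ≤ x) :
    force p s x ≤ Real.exp (2 * s + (x - p)) := by
  rw [force, Real.exp_add]
  refine mul_le_mul_of_nonneg_left ?_ (Real.exp_pos _).le
  have h1 : x / p ≤ Real.exp (x / p - 1) := by
    have := Real.add_one_le_exp (x / p - 1)
    linarith
  calc (x / p) ^ p ≤ (Real.exp (x / p - 1)) ^ p :=
        Real.rpow_le_rpow (div_nonneg hx hp.le) h1 hp.le
    _ = Real.exp (x - p) := by
        rw [← Real.exp_mul]
        congr 1
        field_simp

theorem continuousOn_force {p : ℝ} (hp : 0 < p) {V : ℝ → ℝ} {A : Set ℝ} (hV : ContinuousOn V A) :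
    ContinuousOn (fun s => force p s (V s)) A := by
  unfold force
  refine ContinuousOn.mul (by fun_prop) ?_
  exact (hV.div_const p).rpow_const fun _ _ => Or.inr hp.le

theorem hasDerivAt_force_mul {p s : ℝ} (hp : 0 < p) {V : ℝ → ℝ} {d : ℝ} (hV : HasDerivAt V d s)
    (hpos : 0 < V s) :
    HasDerivAt (fun s => force p s (V s) * V s / (p + 1))
      (2 * (force p s (V s) * V s / (p + 1)) + force p s (V s) * d) s := by
  have h1 : HasDerivAt (fun s : ℝ => Real.exp (2 * s)) (Real.exp (2 * s) * 2) s := by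
    simpa using ((hasDerivAt_id s).const_mul 2).exp
  have hq : 0 < V s / p := div_pos hpos hp
  have h2 : HasDerivAt (fun s => (V s / p) ^ p) (d / p * p * (V s / p) ^ (p - 1)) s :=
    (hV.div_const p).rpow_const (Or.inl hq.ne')
  have h3 := ((h1.mul h2).mul hV).div_const (p + 1)
  unfold force
  refine h3.congr_deriv ?_
  rw [Real.rpow_sub_one hq.ne']
  simp only [Pi.mul_apply]
  field_simp
  ring

/-! ### The inner nodal region -/

/-- A positive solution on a half-line `(-∞, b]` of the Lane–Emden equation in logarithmic
coordinates, emanating from its maximum `p` at `-∞`, with first zero at `b`. -/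
structure InnerProfile (p b : ℝ) (V D : ℝ → ℝ) : Prop where
  contV : ContinuousOn V (Iic b)
  contD : ContinuousOn D (Iic b)
  derivV : ∀ s < b, HasDerivAt V (D s) s
  derivD : ∀ s < b, HasDerivAt D (-force p s (V s)) s
  limV : Tendsto V atBot (nhds p)
  limD : Tendsto D atBot (nhds 0)
  pos : ∀ s < b, 0 < V s
  zero : V b = 0

namespace InnerProfile

variable {p b : ℝ} {V D : ℝ → ℝ}

theorem nonneg (h : InnerProfile p b V D) {s : ℝ} (hs : s ≤ b) : 0 ≤ V s := by
  rcases hs.lt_or_eq with hs | rfl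
  · exact (h.pos s hs).le
  · exact h.zero.ge

theorem D_nonpos (h : InnerProfile p b V D) (hp : 0 < p) {s : ℝ} (hs : s ≤ b) : D s ≤ 0 :=
  le_of_tendsto_atBot_of_hasDerivAt_nonpos h.contD h.derivD
    (fun x hx => neg_nonpos.2 (force_nonneg hp (h.pos x hx).le)) h.limD hs

theorem V_le (h : InnerProfile p b V D) (hp : 0 < p) {s : ℝ} (hs : s ≤ b) : V s ≤ p :=
  le_of_tendsto_atBot_of_hasDerivAt_nonpos h.contV h.derivV
    (fun _ hx => h.D_nonpos hp hx.le) h.limV hs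

theorem D_antitone (h : InnerProfile p b V D) (hp : 0 < p) {x y : ℝ} (hxy : x ≤ y) (hy : y ≤ b) :
    D y ≤ D x :=
  le_of_hasDerivAt_nonpos hxy (h.contD.mono fun _ hz => hz.2.trans hy)
    (fun z hz => h.derivD z (hz.2.trans_le hy))
    (fun z hz => neg_nonpos.2 (force_nonneg hp (h.pos z (hz.2.trans_le hy)).le))

theorem tendsto_exp_atBot {k : ℝ} (hk : 0 < k) :
    Tendsto (fun s : ℝ => Real.exp (k * s)) atBot (nhds 0) :=
  Real.tendsto_exp_atBot.comp (tendsto_id.const_mul_atBot hk)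

theorem hasDerivAt_exp_mul (k s : ℝ) :
    HasDerivAt (fun s : ℝ => Real.exp (k * s)) (k * Real.exp (k * s)) s := by
  have := ((hasDerivAt_id s).const_mul k).exp
  simp only [id, mul_one] at this
  rwa [mul_comm] at this

theorem force_le_exp_two_mul (h : InnerProfile p b V D) (hp : 0 < p) {s : ℝ} (hs : s ≤ b) :
    force p s (V s) ≤ Real.exp (2 * s) :=
  (force_le_exp hp (h.nonneg hs)).trans (Real.exp_le_exp.2 (by linarith [h.V_le hp hs]))

theorem D_ge_exp (h : InnerProfile p b V D) (hp : 0 < p) {s : ℝ} (hs : s ≤ b) :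
    -(Real.exp (2 * s) / 2) ≤ D s := by
  have := ge_of_tendsto_atBot_of_hasDerivAt_nonneg (F := fun s => D s + Real.exp (2 * s) / 2)
    (F' := fun s => -force p s (V s) + 2 * Real.exp (2 * s) / 2) (l := 0 + 0 / 2)
    (h.contD.add (by fun_prop))
    (fun s hs => (h.derivD s hs).add ((hasDerivAt_exp_mul 2 s).div_const 2))
    (fun s hs => by linarith [h.force_le_exp_two_mul hp hs.le])
    (h.limD.add ((tendsto_exp_atBot two_pos).div_const 2)) hs
  linarith

theorem V_ge_exp (h : InnerProfile p b V D) (hp : 0 < p) {s : ℝ} (hs : s ≤ b) :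
    p - Real.exp (2 * s) / 4 ≤ V s := by
  have := ge_of_tendsto_atBot_of_hasDerivAt_nonneg (F := fun s => V s + Real.exp (2 * s) / 4)
    (F' := fun s => D s + 2 * Real.exp (2 * s) / 4) (l := p + 0 / 4)
    (h.contV.add (by fun_prop))
    (fun s hs => (h.derivV s hs).add ((hasDerivAt_exp_mul 2 s).div_const 4))
    (fun s hs => by linarith [h.D_ge_exp hp hs.le])
    (h.limV.add ((tendsto_exp_atBot two_pos).div_const 4)) hs
  linarith

theorem D_le_exp (h : InnerProfile p b V D) (hp : 1 < p) {s : ℝ} (hs : s ≤ b) :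
    D s ≤ -(Real.exp (2 * s) / 2) + Real.exp (4 * s) / 16 := by
  have hp0 : 0 < p := by linarith
  have := le_of_tendsto_atBot_of_hasDerivAt_nonpos
    (F := fun s => D s + Real.exp (2 * s) / 2 - Real.exp (4 * s) / 16)
    (F' := fun s => -force p s (V s) + 2 * Real.exp (2 * s) / 2 - 4 * Real.exp (4 * s) / 16)
    (l := 0 + 0 / 2 - 0 / 16)
    ((h.contD.add (by fun_prop)).sub (by fun_prop))
    (fun s hs => ((h.derivD s hs).add ((hasDerivAt_exp_mul 2 s).div_const 2)).sub
      ((hasDerivAt_exp_mul 4 s).div_const 16))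
    (fun s hs => by
      have h1 : 1 + p * (V s / p - 1) ≤ (1 + (V s / p - 1)) ^ p :=
        one_add_mul_self_le_rpow_one_add (by linarith [div_pos (h.pos s hs) hp0]) hp.le
      have h2 : p * (V s / p - 1) = V s - p := by field_simp
      rw [h2, add_sub_cancel] at h1
      have h3 : Real.exp (4 * s) = Real.exp (2 * s) * Real.exp (2 * s) := by
        rw [← Real.exp_add]; ring_nf
      have h4 := h.V_ge_exp hp0 hs.le
      have h5 : Real.exp (2 * s) * (1 - Real.exp (2 * s) / 4) ≤ force p s (V s) :=
        mul_le_mul_of_nonneg_left (by linarith) (Real.exp_pos _).le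
      rw [h3]
      linarith)
    ((h.limD.add ((tendsto_exp_atBot two_pos).div_const 2)).sub
      ((tendsto_exp_atBot four_pos).div_const 16)) hs
  linarith

/-- The Pohozaev functional. -/
def pohozaev (p : ℝ) (V D : ℝ → ℝ) (s : ℝ) : ℝ :=
  D s ^ 2 / 2 + 2 * D s + force p s (V s) * V s / (p + 1)

theorem contPohozaev (h : InnerProfile p b V D) (hp : 0 < p) :
    ContinuousOn (pohozaev p V D) (Iic b) := by
  have h1 := h.contD
  have h2 := h.contV
  have h3 := continuousOn_force hp h.contV
  unfold pohozaev
  fun_prop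

theorem limPohozaev (h : InnerProfile p b V D) (hp : 0 < p) :
    Tendsto (pohozaev p V D) atBot (nhds 0) := by
  have h1 : Tendsto (fun s => force p s (V s)) atBot (nhds 0) := by
    refine squeeze_zero' ?_ ?_ (tendsto_exp_atBot two_pos)
    · filter_upwards [eventually_le_atBot b] with s hs using force_nonneg hp (h.nonneg hs)
    · filter_upwards [eventually_le_atBot b] with s hs using h.force_le_exp_two_mul hp hs
  have : Tendsto (pohozaev p V D) atBot (nhds (0 ^ 2 / 2 + 2 * 0 + 0 * p / (p + 1))) :=
    (((h.limD.pow 2).div_const 2).add (h.limD.const_mul 2)).add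
      ((h1.mul h.limV).div_const (p + 1))
  simpa using this

theorem hasDerivAt_pohozaev (h : InnerProfile p b V D) (hp : 0 < p) {s : ℝ} (hs : s < b) :
    HasDerivAt (pohozaev p V D) (-(2 / (p + 1)) * force p s (V s) * (p + 1 - V s)) s := by
  have hD := h.derivD s hs
  have := (((hD.pow 2).div_const 2).add (hD.const_mul 2)).add
    (hasDerivAt_force_mul hp (h.derivV s hs) (h.pos s hs))
  refine this.congr_deriv ?_
  field_simp
  norm_num
  ring

theorem pohozaev_nonpos (h : InnerProfile p b V D) (hp : 0 < p) {s : ℝ} (hs : s ≤ b) :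
    pohozaev p V D s ≤ 0 :=
  le_of_tendsto_atBot_of_hasDerivAt_nonpos (h.contPohozaev hp)
    (fun _ hx => h.hasDerivAt_pohozaev hp hx)
    (fun x hx => by
      have h1 := force_nonneg (s := x) hp (h.pos x hx).le
      have h2 := h.V_le hp hx.le
      have h3 : 0 ≤ 2 / (p + 1) * force p x (V x) * (p + 1 - V x) := by
        apply mul_nonneg <;> [positivity; linarith]
      linarith) (h.limPohozaev hp) hs

theorem D_ge_neg_four (h : InnerProfile p b V D) (hp : 0 < p) {s : ℝ} (hs : s ≤ b) : -4 ≤ D s := by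
  have h1 := h.pohozaev_nonpos hp hs
  have h2 := force_nonneg (s := s) hp (h.nonneg hs)
  have h3 : 0 ≤ force p s (V s) * V s / (p + 1) :=
    div_nonneg (mul_nonneg h2 (h.nonneg hs)) (by linarith)
  unfold pohozaev at h1
  have h4 := h.D_nonpos hp hs
  by_contra hcon
  nlinarith

theorem pohozaev_ge (h : InnerProfile p b V D) (hp : 0 < p) {s : ℝ} (hs : s ≤ b) :
    2 / (p + 1) * (D s * (p + 1 - V s)) ≤ pohozaev p V D s := by
  have hcV := h.contV
  have hcD := h.contD
  have := ge_of_tendsto_atBot_of_hasDerivAt_nonneg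
    (F := fun s => pohozaev p V D s - 2 / (p + 1) * (D s * (p + 1 - V s)))
    (F' := fun s => 2 / (p + 1) * D s ^ 2) (l := 0 - 2 / (p + 1) * (0 * (p + 1 - p)))
    ((h.contPohozaev hp).sub (by fun_prop))
    (fun s hs => by
      refine ((h.hasDerivAt_pohozaev hp hs).sub
        (((h.derivD s hs).mul ((h.derivV s hs).const_sub (p + 1))).const_mul
          (2 / (p + 1)))).congr_deriv ?_
      ring)
    (fun s hs => by positivity)
    ((h.limPohozaev hp).sub ((h.limD.mul (h.limV.const_sub (p + 1))).const_mul _)) hs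
  linarith

theorem V_ge_linear (h : InnerProfile p b V D) (hp : 0 < p) {s : ℝ} (h0 : 0 ≤ s) (hs : s ≤ b) :
    p - 1 / 4 - 4 * s ≤ V s := by
  have h1 := h.V_ge_exp hp (h0.trans hs)
  simp only [mul_zero, Real.exp_zero] at h1
  have := le_of_hasDerivAt_nonneg (F := fun s => V s + 4 * s) (F' := fun s => D s + 4 * 1) h0
    ((h.contV.mono fun z hz => hz.2.trans hs).add (by fun_prop))
    (fun z hz => (h.derivV z (hz.2.trans_le hs)).add ((hasDerivAt_id z).const_mul 4))
    (fun z hz => by linarith [h.D_ge_neg_four hp (hz.2.trans_le hs).le])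
  linarith

theorem le_zero_point (h : InnerProfile p b V D) (hp : 1 < p) : (p - 1 / 4) / 4 ≤ b := by
  have hp0 : 0 < p := by linarith
  have hb : 0 ≤ b := by
    by_contra hb
    have h1 := h.V_ge_exp hp0 (s := b) le_rfl
    rw [h.zero] at h1
    have : Real.exp (2 * b) ≤ 1 := Real.exp_le_one_iff.2 (by linarith)
    linarith
  have h1 := h.V_ge_linear hp0 hb le_rfl
  rw [h.zero] at h1
  linarith

theorem D_six_le (h : InnerProfile p b V D) (hp : 1000 < p) : D 6 ≤ -3 := by
  have hp0 : 0 < p := by linarith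
  have hb : 6 ≤ b := by linarith [h.le_zero_point (by linarith)]
  by_contra! hcon
  have h0 := h.D_le_exp (by linarith) (s := 0) (by linarith)
  simp only [mul_zero, Real.exp_zero] at h0
  have := le_of_hasDerivAt_nonpos (F := fun s => D s + 1 / 2 * s)
    (F' := fun s => -force p s (V s) + 1 / 2 * 1) (a := 0) (b := 6) (by norm_num)
    ((h.contD.mono fun z hz => hz.2.trans hb).add (by fun_prop))
    (fun z hz => (h.derivD z (hz.2.trans_le hb)).add ((hasDerivAt_id z).const_mul _))
    (fun z hz => by
      have hzb : z ≤ b := hz.2.le.trans hb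
      have h1 := h.D_antitone hp0 hz.2.le hb
      have h2 := h.D_antitone hp0 hz.1.le hzb
      have h3 := h.pohozaev_ge hp0 hzb
      have h4 := h.V_ge_linear hp0 hz.1.le hzb
      have h5 := h.V_le hp0 hzb
      have h6 := force_nonneg (s := z) hp0 (h.nonneg hzb)
      have h7 : force p z (V z) * V z / (p + 1) ≤ force p z (V z) := by
        rw [div_le_iff₀ (by linarith)]
        exact mul_le_mul_of_nonneg_left (by linarith) h6
      have h8 : -(1 / 4) ≤ 2 / (p + 1) * (D z * (p + 1 - V z)) := by
        have h9 : -104 ≤ D z * (p + 1 - V z) := by nlinarith [hz.2]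
        have h10 : -104 * (2 / (p + 1)) ≤ 2 / (p + 1) * (D z * (p + 1 - V z)) := by
          rw [mul_comm]
          exact mul_le_mul_of_nonneg_left h9 (by positivity)
        refine le_trans ?_ h10
        have : 2 / (p + 1) ≤ 1 / 416 := by
          rw [div_le_div_iff₀ (by linarith) (by norm_num)]
          linarith
        linarith
      unfold pohozaev at h3
      nlinarith)
  linarith

theorem force_le (h : InnerProfile p b V D) (hp : 1000 < p) {s : ℝ} (h6 : 6 ≤ s) (hs : s ≤ b) :
    force p s (V s) ≤ Real.exp (18 - s) := by
  have hp0 : 0 < p := by linarith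
  refine (force_le_exp hp0 (h.nonneg hs)).trans (Real.exp_le_exp.2 ?_)
  have h1 := le_of_hasDerivAt_nonpos (F := fun s => V s + 3 * s) (F' := fun s => D s + 3 * 1) h6
    ((h.contV.mono fun z hz => hz.2.trans hs).add (by fun_prop))
    (fun z hz => (h.derivV z (hz.2.trans_le hs)).add ((hasDerivAt_id z).const_mul 3))
    (fun z hz => by
      linarith [h.D_antitone hp0 hz.1.le (hz.2.le.trans hs), h.D_six_le hp])
  have h2 := h.V_le hp0 (h6.trans hs)
  linarith

/-- A bound for the deviation of the slope of the profile from its limit `-4`. -/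
def slopeError (p : ℝ) : ℝ := Real.exp (18 - √p) + 8 / (p + 1) * (5 / 4 + 4 * √p)

theorem D_sqrt_le (h : InnerProfile p b V D) (hp : 1000 < p) (hb : √p ≤ b) :
    D (√p) ≤ -4 + slopeError p := by
  have hp0 : 0 < p := by linarith
  have h6 : 6 ≤ √p := Real.le_sqrt_of_sq_le (by linarith)
  have h1 := h.pohozaev_ge hp0 hb
  have h2 := h.V_ge_linear hp0 (by linarith) hb
  have h3 := h.force_le hp h6 hb
  have h4 := force_nonneg (s := √p) hp0 (h.nonneg hb)
  have h5 := h.D_antitone hp0 h6 hb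
  have h7 := h.D_six_le hp
  have h8 := h.D_ge_neg_four hp0 hb
  have h9 := h.V_le hp0 hb
  have h10 : force p (√p) (V (√p)) * V (√p) / (p + 1) ≤ force p (√p) (V (√p)) := by
    rw [div_le_iff₀ (by linarith)]
    exact mul_le_mul_of_nonneg_left (by linarith) h4
  have h11 : -(8 / (p + 1) * (5 / 4 + 4 * √p)) ≤ 2 / (p + 1) * (D (√p) * (p + 1 - V (√p))) := by
    have h12 : -4 * (5 / 4 + 4 * √p) ≤ D (√p) * (p + 1 - V (√p)) := by nlinarith
    have := mul_le_mul_of_nonneg_left h12 (show 0 ≤ 2 / (p + 1) by positivity)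
    refine le_trans (le_of_eq ?_) this
    ring
  unfold pohozaev at h1
  unfold slopeError
  nlinarith

theorem zero_point_le (h : InnerProfile p b V D) (hp : 1000 < p) (hb : √p ≤ b)
    (he : slopeError p < 4) : b ≤ √p + p / (4 - slopeError p) := by
  have hp0 : 0 < p := by linarith
  have h1 := le_of_hasDerivAt_nonpos (F := fun s => V s + (4 - slopeError p) * s)
    (F' := fun s => D s + (4 - slopeError p) * 1) hb
    ((h.contV.mono fun z hz => hz.2).add (by fun_prop))
    (fun z hz => (h.derivV z hz.2).add ((hasDerivAt_id z).const_mul _))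
    (fun z hz => by linarith [h.D_antitone hp0 hz.1.le hz.2.le, h.D_sqrt_le hp hb])
  have h2 := h.V_le hp0 hb
  simp only [h.zero] at h1
  have h3 : b - √p ≤ p / (4 - slopeError p) := by
    rw [le_div_iff₀ (by linarith)]
    linarith
  linarith

end InnerProfile

/-! ### The outer nodal region -/

/-- A positive solution on `[a, b]` of the Lane–Emden equation in logarithmic coordinates,
vanishing at the end points, with critical point `m`. -/
structure OuterProfile (p a m b : ℝ) (W E : ℝ → ℝ) : Prop where
  contW : ContinuousOn W (Icc a b)
  contE : ContinuousOn E (Icc a b)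
  derivW : ∀ s ∈ Ioo a b, HasDerivAt W (E s) s
  derivE : ∀ s ∈ Ioo a b, HasDerivAt E (-force p s (W s)) s
  pos : ∀ s ∈ Ioo a b, 0 < W s
  left_zero : W a = 0
  right_zero : W b = 0
  crit : E m = 0
  left_lt : a < m
  lt_right : m < b

namespace OuterProfile

variable {p a m b : ℝ} {W E : ℝ → ℝ}

theorem nonneg (h : OuterProfile p a m b W E) {s : ℝ} (ha : a ≤ s) (hb : s ≤ b) : 0 ≤ W s := by
  rcases ha.lt_or_eq with ha | rfl
  · rcases hb.lt_or_eq with hb | rfl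
    · exact (h.pos s ⟨ha, hb⟩).le
    · exact h.right_zero.ge
  · exact h.left_zero.ge

theorem E_antitone (h : OuterProfile p a m b W E) (hp : 0 < p) {x y : ℝ} (hx : a ≤ x)
    (hxy : x ≤ y) (hy : y ≤ b) : E y ≤ E x :=
  le_of_hasDerivAt_nonpos hxy (h.contE.mono (Icc_subset_Icc hx hy))
    (fun z hz => h.derivE z ⟨hx.trans_lt hz.1, hz.2.trans_le hy⟩)
    (fun z hz => neg_nonpos.2 (force_nonneg hp (h.pos z ⟨hx.trans_lt hz.1, hz.2.trans_le hy⟩).le))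

theorem le_add_left_slope (h : OuterProfile p a m b W E) (hp : 0 < p) {x y : ℝ} (hx : a ≤ x)
    (hxy : x ≤ y) (hy : y ≤ b) : W y ≤ W x + E x * (y - x) := by
  have := le_of_hasDerivAt_nonpos (F := fun s => W s - E x * s) (F' := fun s => E s - E x * 1) hxy
    ((h.contW.mono (Icc_subset_Icc hx hy)).sub (by fun_prop))
    (fun z hz => (h.derivW z ⟨hx.trans_lt hz.1, hz.2.trans_le hy⟩).sub
      ((hasDerivAt_id z).const_mul _))
    (fun z hz => by linarith [h.E_antitone hp hx hz.1.le (hz.2.le.trans hy)])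
  linarith

theorem add_right_slope_le (h : OuterProfile p a m b W E) (hp : 0 < p) {x y : ℝ} (hx : a ≤ x)
    (hxy : x ≤ y) (hy : y ≤ b) : W x + E y * (y - x) ≤ W y := by
  have := le_of_hasDerivAt_nonneg (F := fun s => W s - E y * s) (F' := fun s => E s - E y * 1) hxy
    ((h.contW.mono (Icc_subset_Icc hx hy)).sub (by fun_prop))
    (fun z hz => (h.derivW z ⟨hx.trans_lt hz.1, hz.2.trans_le hy⟩).sub
      ((hasDerivAt_id z).const_mul _))
    (fun z hz => by linarith [h.E_antitone hp (hx.trans hz.1.le) hz.2.le hy])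
  linarith

theorem W_mono (h : OuterProfile p a m b W E) (hp : 0 < p) {x y : ℝ} (hx : a ≤ x)
    (hxy : x ≤ y) (hy : y ≤ m) : W x ≤ W y := by
  have h1 := h.add_right_slope_le hp hx hxy (hy.trans h.lt_right.le)
  have h2 := h.E_antitone hp (hx.trans hxy) hy h.lt_right.le
  rw [h.crit] at h2
  nlinarith

theorem W_anti (h : OuterProfile p a m b W E) (hp : 0 < p) {x y : ℝ} (hx : m ≤ x)
    (hxy : x ≤ y) (hy : y ≤ b) : W y ≤ W x := by
  have h1 := h.le_add_left_slope hp (h.left_lt.le.trans hx) hxy hy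
  have h2 := h.E_antitone hp h.left_lt.le hx (hxy.trans hy)
  rw [h.crit] at h2
  nlinarith

theorem W_le_max (h : OuterProfile p a m b W E) (hp : 0 < p) {s : ℝ} (ha : a ≤ s) (hb : s ≤ b) :
    W s ≤ W m := by
  rcases le_total s m with hs | hs
  · exact h.W_mono hp ha hs le_rfl
  · exact h.W_anti hp le_rfl hs hb

/-- The energy functional in logarithmic coordinates. -/
def energy (p : ℝ) (W E : ℝ → ℝ) (s : ℝ) : ℝ := E s ^ 2 / 2 + force p s (W s) * W s / (p + 1)

theorem hasDerivAt_energy (h : OuterProfile p a m b W E) (hp : 0 < p) {s : ℝ}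
    (hs : s ∈ Ioo a b) :
    HasDerivAt (energy p W E) (2 * (force p s (W s) * W s / (p + 1))) s := by
  refine ((((h.derivE s hs).pow 2).div_const 2).add
    (hasDerivAt_force_mul hp (h.derivW s hs) (h.pos s hs))).congr_deriv ?_
  field_simp
  norm_num
  ring

theorem contEnergy (h : OuterProfile p a m b W E) (hp : 0 < p) :
    ContinuousOn (energy p W E) (Icc a b) := by
  have h1 := h.contE
  have h2 := h.contW
  have h3 := continuousOn_force hp h.contW
  unfold energy
  fun_prop

theorem energy_left (h : OuterProfile p a m b W E) : energy p W E a = E a ^ 2 / 2 := by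
  simp [energy, h.left_zero]

theorem energy_right (h : OuterProfile p a m b W E) : energy p W E b = E b ^ 2 / 2 := by
  simp [energy, h.right_zero]

theorem energy_add_le (h : OuterProfile p a m b W E) (hp : 0 < p) {x y K : ℝ} (hx : a ≤ x)
    (hxy : x ≤ y) (hy : y ≤ b) (hK : ∀ s ∈ Ioo x y, W s ≤ K) :
    energy p W E y + 2 * K / (p + 1) * E y ≤ energy p W E x + 2 * K / (p + 1) * E x := by
  have hcE := h.contE.mono (Icc_subset_Icc hx hy)
  refine le_of_hasDerivAt_nonpos (F := fun s => energy p W E s + 2 * K / (p + 1) * E s)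
    (F' := fun s => 2 * (force p s (W s) * W s / (p + 1)) + 2 * K / (p + 1) * -force p s (W s)) hxy
    (((h.contEnergy hp).mono (Icc_subset_Icc hx hy)).add (by fun_prop))
    (fun z hz => (h.hasDerivAt_energy hp ⟨hx.trans_lt hz.1, hz.2.trans_le hy⟩).add
      ((h.derivE z ⟨hx.trans_lt hz.1, hz.2.trans_le hy⟩).const_mul _)) (fun z hz => ?_)
  have h1 := force_nonneg (s := z) hp (h.pos z ⟨hx.trans_lt hz.1, hz.2.trans_le hy⟩).le
  have h2 : 0 ≤ 2 * force p z (W z) / (p + 1) * (K - W z) :=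
    mul_nonneg (by positivity) (by linarith [hK z hz])
  refine le_of_eq_of_le (?_ : _ = -(2 * force p z (W z) / (p + 1) * (K - W z))) (by linarith)
  ring

theorem le_energy_add (h : OuterProfile p a m b W E) (hp : 0 < p) {x y K : ℝ} (hx : a ≤ x)
    (hxy : x ≤ y) (hy : y ≤ b) (hK : ∀ s ∈ Ioo x y, K ≤ W s) :
    energy p W E x + 2 * K / (p + 1) * E x ≤ energy p W E y + 2 * K / (p + 1) * E y := by
  have hcE := h.contE.mono (Icc_subset_Icc hx hy)
  refine le_of_hasDerivAt_nonneg (F := fun s => energy p W E s + 2 * K / (p + 1) * E s)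
    (F' := fun s => 2 * (force p s (W s) * W s / (p + 1)) + 2 * K / (p + 1) * -force p s (W s)) hxy
    (((h.contEnergy hp).mono (Icc_subset_Icc hx hy)).add (by fun_prop))
    (fun z hz => (h.hasDerivAt_energy hp ⟨hx.trans_lt hz.1, hz.2.trans_le hy⟩).add
      ((h.derivE z ⟨hx.trans_lt hz.1, hz.2.trans_le hy⟩).const_mul _)) (fun z hz => ?_)
  have h1 := force_nonneg (s := z) hp (h.pos z ⟨hx.trans_lt hz.1, hz.2.trans_le hy⟩).le
  have h2 : 0 ≤ 2 * force p z (W z) / (p + 1) * (W z - K) :=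
    mul_nonneg (by positivity) (by linarith [hK z hz])
  refine le_of_le_of_eq h2 ?_
  ring

theorem energy_mono (h : OuterProfile p a m b W E) (hp : 0 < p) {x y : ℝ} (hx : a ≤ x)
    (hxy : x ≤ y) (hy : y ≤ b) : energy p W E x ≤ energy p W E y := by
  have := h.le_energy_add hp (K := 0) hx hxy hy
    (fun s hs => h.nonneg (hx.trans hs.1.le) (hs.2.le.trans hy))
  simpa using this

theorem left_slope_nonneg (h : OuterProfile p a m b W E) (hp : 0 < p) : 0 ≤ E a := by
  have := h.E_antitone hp le_rfl h.left_lt.le h.lt_right.le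
  rwa [h.crit] at this

theorem max_pos (h : OuterProfile p a m b W E) : 0 < W m := h.pos m ⟨h.left_lt, h.lt_right⟩

theorem force_max_le (h : OuterProfile p a m b W E) (hp : 0 < p) :
    force p m (W m) * W m / (p + 1) ≤ E a ^ 2 / 2 + 2 * W m / (p + 1) * E a := by
  have := h.energy_add_le hp (K := W m) le_rfl h.left_lt.le h.lt_right.le
    (fun s hs => h.W_mono hp hs.1.le hs.2.le le_rfl)
  rw [h.energy_left, energy, h.crit] at this
  linarith

theorem mul_right_slope_ge (h : OuterProfile p a m b W E) (hp : 0 < p) :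
    W m ≤ -E b * (b - m) := by
  have := h.add_right_slope_le hp h.left_lt.le h.lt_right.le le_rfl
  rw [h.right_zero] at this
  linarith

theorem right_slope_neg (h : OuterProfile p a m b W E) (hp : 0 < p) : E b < 0 := by
  have h1 := h.mul_right_slope_ge hp
  have h2 := h.max_pos
  have h3 := h.lt_right
  by_contra hcon
  nlinarith

theorem right_slope_le (h : OuterProfile p a m b W E) (hp : 0 < p) :
    -E b ≤ E a + 4 * W m / (p + 1) := by
  have h1 := h.energy_add_le hp (K := W m) le_rfl (h.left_lt.le.trans h.lt_right.le) le_rfl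
    (fun s hs => h.W_le_max hp hs.1.le hs.2.le)
  rw [h.energy_left, h.energy_right] at h1
  have h2 := h.right_slope_neg hp
  have h3 := h.left_slope_nonneg hp
  have h4 : 4 * W m / (p + 1) = 2 * (2 * W m / (p + 1)) := by ring
  rw [h4]
  by_contra! hcon
  nlinarith

theorem force_le_rpow (h : OuterProfile p a m b W E) (hp : 0 < p) (hE : E a ≤ 4) {L s : ℝ}
    (ha : a ≤ s) (hb : s ≤ b) (hL : s ≤ L) :
    force p s (W s) ≤ (Real.exp (2 * (L / p)) * (4 * (L / p - a / p))) ^ p := by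
  have h1 := h.le_add_left_slope hp le_rfl ha hb
  rw [h.left_zero] at h1
  have h2 : W s / p ≤ 4 * (L / p - a / p) := by
    rw [div_le_iff₀ hp]
    have : 4 * (L / p - a / p) * p = 4 * (L - a) := by field_simp
    rw [this]
    nlinarith
  have h3 : 0 ≤ W s / p := div_nonneg (h.nonneg ha hb) hp.le
  rw [Real.mul_rpow (Real.exp_pos _).le (h3.trans h2), ← Real.exp_mul, force]
  refine mul_le_mul (Real.exp_le_exp.2 ?_) (Real.rpow_le_rpow h3 h2 hp.le)
    (Real.rpow_nonneg h3 _) (Real.exp_pos _).le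
  have : 2 * (L / p) * p = 2 * L := by field_simp
  linarith

theorem slope_ge (h : OuterProfile p a m b W E) (hp : 0 < p) (hE : E a ≤ 4) {L s q : ℝ}
    (ha : a ≤ s) (hb : s ≤ b) (hL : s ≤ L)
    (hq : Real.exp (2 * (L / p)) * (4 * (L / p - a / p)) ≤ q) : E a - (s - a) * q ^ p ≤ E s := by
  have := le_of_hasDerivAt_nonneg (F := fun s => E s + q ^ p * s)
    (F' := fun s => -force p s (W s) + q ^ p * 1) ha
    ((h.contE.mono (Icc_subset_Icc le_rfl hb)).add (by fun_prop))
    (fun z hz => (h.derivE z ⟨hz.1, hz.2.trans_le hb⟩).add ((hasDerivAt_id z).const_mul _))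
    (fun z hz => by
      have h1 := h.force_le_rpow hp hE hz.1.le (hz.2.le.trans hb) (hz.2.le.trans hL)
      have h2 : 0 ≤ Real.exp (2 * (L / p)) * (4 * (L / p - a / p)) := by
        refine mul_nonneg (Real.exp_pos _).le ?_
        have : a / p ≤ L / p := div_le_div_of_nonneg_right (ha.trans hL) hp.le
        linarith
      have h3 := Real.rpow_le_rpow h2 hq hp.le
      linarith)
  linarith

theorem slope_add_two_le (h : OuterProfile p a m b W E) (hp : 0 < p) (hE : 7 / 2 ≤ E a)
    (hm : W m ≤ p) (hb : m + 2 ≤ b) : E (m + 2) ≤ -3 := by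
  by_contra! hcon
  have := le_of_hasDerivAt_nonpos (F := fun s => E s + 3 / 2 * s)
    (F' := fun s => -force p s (W s) + 3 / 2 * 1) (a := m) (b := m + 2) (by linarith)
    ((h.contE.mono (Icc_subset_Icc h.left_lt.le hb)).add (by fun_prop))
    (fun z hz => (h.derivE z ⟨h.left_lt.trans hz.1, hz.2.trans_le hb⟩).add
      ((hasDerivAt_id z).const_mul _))
    (fun z hz => by
      have hza := h.left_lt.trans hz.1
      have hzb := hz.2.trans_le hb
      have h1 := h.energy_mono hp le_rfl hza.le hzb.le
      rw [h.energy_left, energy] at h1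
      have h2 := h.E_antitone hp hza.le hz.2.le hb
      have h3 := h.E_antitone hp h.left_lt.le hz.1.le hzb.le
      rw [h.crit] at h3
      have h4 := force_nonneg (s := z) hp (h.nonneg hza.le hzb.le)
      have h5 : force p z (W z) * W z / (p + 1) ≤ force p z (W z) := by
        rw [div_le_iff₀ (by linarith)]
        exact mul_le_mul_of_nonneg_left (by linarith [h.W_le_max hp hza.le hzb.le]) h4
      nlinarith)
  linarith [h.crit]

theorem force_le_force_max (h : OuterProfile p a m b W E) (hp : 0 < p) (hE : 7 / 2 ≤ E a)
    (hm : W m ≤ p) {s : ℝ} (hs : m + 2 ≤ s) (hb : s ≤ b) :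
    force p s (W s) ≤ force p m (W m) * Real.exp (6 + m - s) := by
  have hW := h.max_pos
  have hsa : a ≤ s := by linarith [h.left_lt]
  have h0 : 0 ≤ W s := h.nonneg hsa hb
  have h1 := h.le_add_left_slope hp (x := m + 2) (by linarith [h.left_lt]) hs hb
  have h2 := h.slope_add_two_le hp hE hm (hs.trans hb)
  have h3 := h.W_le_max hp (s := m + 2) (by linarith [h.left_lt]) (hs.trans hb)
  have h4 : W s - W m ≤ -3 * (s - m - 2) := by nlinarith
  have h5 : W s / p = W m / p * (W s / W m) := by field_simp
  have h6 : (W s / W m) ^ p ≤ Real.exp (-3 * (s - m - 2)) := by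
    have h7 : W s / W m ≤ Real.exp (W s / W m - 1) := by
      have := Real.add_one_le_exp (W s / W m - 1)
      linarith
    calc (W s / W m) ^ p ≤ (Real.exp (W s / W m - 1)) ^ p :=
          Real.rpow_le_rpow (div_nonneg h0 hW.le) h7 hp.le
      _ = Real.exp ((W s / W m - 1) * p) := by rw [← Real.exp_mul]
      _ ≤ Real.exp (-3 * (s - m - 2)) := by
          refine Real.exp_le_exp.2 (le_trans ?_ h4)
          have h8 : (W s / W m - 1) * p = (W s - W m) * (p / W m) := by field_simp
          have h9 : 1 ≤ p / W m := (one_le_div hW).2 hm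
          rw [h8]
          nlinarith [h.W_le_max hp hsa hb]
  unfold force
  rw [h5, Real.mul_rpow (div_pos hW hp).le (div_nonneg h0 hW.le)]
  have h10 : Real.exp (2 * s) * Real.exp (-3 * (s - m - 2)) =
      Real.exp (2 * m) * Real.exp (6 + m - s) := by
    rw [← Real.exp_add, ← Real.exp_add]
    ring_nf
  have h11 : 0 ≤ (W m / p) ^ p := Real.rpow_nonneg (div_pos hW hp).le _
  calc Real.exp (2 * s) * ((W m / p) ^ p * (W s / W m) ^ p)
      ≤ Real.exp (2 * s) * ((W m / p) ^ p * Real.exp (-3 * (s - m - 2))) := by gcongr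
    _ = (W m / p) ^ p * (Real.exp (2 * s) * Real.exp (-3 * (s - m - 2))) := by ring
    _ = _ := by rw [h10]; ring

theorem slope_le_right (h : OuterProfile p a m b W E) (hp : 0 < p) (hE : 7 / 2 ≤ E a)
    (hm : W m ≤ p) {s : ℝ} (hs : m + 2 ≤ s) (hb : s ≤ b) :
    E s ≤ E b + force p m (W m) * Real.exp (6 + m - s) := by
  have h0 := force_nonneg (s := m) hp h.max_pos.le
  have := le_of_hasDerivAt_nonneg
    (F := fun s => E s - force p m (W m) * Real.exp (6 + m - s))
    (F' := fun s => -force p s (W s) - force p m (W m) * (Real.exp (6 + m - s) * -1)) hb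
    ((h.contE.mono (Icc_subset_Icc (by linarith [h.left_lt]) le_rfl)).sub (by fun_prop))
    (fun z hz => (h.derivE z ⟨by linarith [h.left_lt, hz.1], hz.2⟩).sub
      (((hasDerivAt_id z).const_sub (6 + m)).exp.const_mul _))
    (fun z hz => by linarith [h.force_le_force_max hp hE hm (hs.trans hz.1.le) hz.2.le])
  have h1 : 0 ≤ force p m (W m) * Real.exp (6 + m - b) := mul_nonneg h0 (Real.exp_pos _).le
  linarith

end OuterProfile

/-! ### Limits for the inner region -/

theorem tendsto_sqrt_div_self : Tendsto (fun p : ℝ => √p / p) atTop (nhds 0) := by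
  have : Tendsto (fun p : ℝ => (√p)⁻¹) atTop (nhds 0) :=
    tendsto_inv_atTop_zero.comp Real.tendsto_sqrt_atTop
  refine this.congr fun p => ?_
  rw [Real.sqrt_div_self]

theorem tendsto_exp_const_sub_sqrt (c : ℝ) :
    Tendsto (fun p : ℝ => Real.exp (c - √p)) atTop (nhds 0) := by
  refine Real.tendsto_exp_atBot.comp ?_
  simpa [sub_eq_add_neg] using
    tendsto_atBot_add_const_left atTop c (tendsto_neg_atTop_atBot.comp Real.tendsto_sqrt_atTop)

namespace InnerProfile

theorem tendsto_slopeError : Tendsto slopeError atTop (nhds 0) := by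
  have h1 : Tendsto (fun p : ℝ => Real.exp (18 - √p) + 48 * (√p / p)) atTop (nhds (0 + 48 * 0)) :=
    (tendsto_exp_const_sub_sqrt 18).add (tendsto_sqrt_div_self.const_mul 48)
  simp only [mul_zero, add_zero] at h1
  refine tendsto_of_tendsto_of_tendsto_of_le_of_le' tendsto_const_nhds h1 ?_ ?_
  · filter_upwards [eventually_ge_atTop 1] with p hp
    unfold slopeError
    positivity
  · filter_upwards [eventually_ge_atTop 1] with p hp
    have h2 : 1 ≤ √p := Real.one_le_sqrt.2 hp
    have h3 : 8 / (p + 1) * (5 / 4 + 4 * √p) ≤ 8 / p * (6 * √p) := by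
      gcongr <;> linarith
    have h4 : 8 / p * (6 * √p) = 48 * (√p / p) := by ring
    unfold slopeError
    linarith

variable {b : ℝ → ℝ} {V D : ℝ → ℝ → ℝ}

theorem eventually_sqrt_le (h : ∀ᶠ p in atTop, InnerProfile p (b p) (V p) (D p)) :
    ∀ᶠ p in atTop, √p ≤ b p := by
  filter_upwards [h, eventually_ge_atTop 1000] with p hI hp
  have h1 := hI.le_zero_point (by linarith)
  have h2 : √p ≤ p / 8 := by
    rw [Real.sqrt_le_left (by linarith)]
    nlinarith
  linarith

theorem tendsto_slope (h : ∀ᶠ p in atTop, InnerProfile p (b p) (V p) (D p)) :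
    Tendsto (fun p => D p (b p)) atTop (nhds (-4)) := by
  have h1 : Tendsto (fun p => -4 + slopeError p) atTop (nhds (-4)) := by
    simpa using tendsto_slopeError.const_add (-4)
  refine tendsto_of_tendsto_of_tendsto_of_le_of_le' tendsto_const_nhds h1 ?_ ?_
  · filter_upwards [h, eventually_gt_atTop 0] with p hI hp using hI.D_ge_neg_four hp le_rfl
  · filter_upwards [h, eventually_sqrt_le h, eventually_gt_atTop 1000] with p hI hb hp
    exact (hI.D_antitone (by linarith) hb le_rfl).trans (hI.D_sqrt_le hp hb)

theorem tendsto_zero_div (h : ∀ᶠ p in atTop, InnerProfile p (b p) (V p) (D p)) :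
    Tendsto (fun p => b p / p) atTop (nhds (1 / 4)) := by
  have h1 : Tendsto (fun p => √p / p + 1 / (4 - slopeError p)) atTop (nhds (0 + 1 / (4 - 0))) :=
    tendsto_sqrt_div_self.add
      (tendsto_const_nhds.div (tendsto_slopeError.const_sub 4) (by norm_num))
  have h2 : Tendsto (fun p : ℝ => (1 - 1 / 4 * p⁻¹) / 4) atTop (nhds ((1 - 1 / 4 * 0) / 4)) :=
    ((tendsto_inv_atTop_zero.const_mul (1 / 4)).const_sub 1).div_const 4
  norm_num at h1 h2
  norm_num
  refine tendsto_of_tendsto_of_tendsto_of_le_of_le' h2 h1 ?_ ?_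
  · filter_upwards [h, eventually_gt_atTop 1] with p hI hp
    have h3 := hI.le_zero_point hp
    rw [le_div_iff₀ (by linarith)]
    have : p⁻¹ * p = 1 := inv_mul_cancel₀ (by linarith)
    linarith
  · filter_upwards [h, eventually_sqrt_le h, eventually_gt_atTop 1000,
      tendsto_slopeError.eventually_lt_const four_pos] with p hI hb hp he
    have h3 := hI.zero_point_le hp hb he
    rw [div_le_iff₀ (by linarith), add_mul, div_mul_cancel₀ _ (by linarith)]
    linarith [div_eq_inv_mul p (4 - slopeError p)]

end InnerProfile

/-! ### Limits for the outer region -/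

namespace OuterProfile

/-- A family of outer profiles whose left ends behave like the right ends of inner profiles. -/
structure Family (a m b : ℝ → ℝ) (W E : ℝ → ℝ → ℝ) : Prop where
  profile : ∀ᶠ p in atTop, OuterProfile p (a p) (m p) (b p) (W p) (E p)
  slope : Tendsto (fun p => E p (a p)) atTop (nhds 4)
  slope_le : ∀ᶠ p in atTop, E p (a p) ≤ 4
  left : Tendsto (fun p => a p / p) atTop (nhds (1 / 4))

namespace Family

variable {a m b : ℝ → ℝ} {W E : ℝ → ℝ → ℝ} {τ : ℝ}

theorem early (h : Family a m b W E) (h0 : 0 < τ) (hτ : (1 + τ) / 2 + Real.log τ = 0)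
    {δ : ℝ} (hδ : 0 < δ) (hδτ : δ < τ / 4) :
    ∀ᶠ p in atTop, p * ((1 + τ) / 4 - δ) < m p ∧ a p ≤ p * ((1 + τ) / 4 - δ) ∧
      τ - 5 * δ ≤ W p (p * ((1 + τ) / 4 - δ)) / p ∧
      E p (a p) - δ ≤ E p (p * ((1 + τ) / 4 - δ)) := by
  set x := (1 + τ) / 4 - δ with hx
  have hx0 : 1 / 4 < x := by linarith
  have hlim : Tendsto (fun p => Real.exp (2 * x) * (4 * (x - a p / p))) atTop
      (nhds (Real.exp (2 * x) * (4 * (x - 1 / 4)))) :=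
    ((h.left.const_sub x).const_mul 4).const_mul _
  have hlt : Real.exp (2 * x) * (4 * (x - 1 / 4)) < 1 := by
    have h1 : Real.exp ((1 + τ) / 2) * τ = 1 := by
      nth_rewrite 2 [← Real.exp_log h0]
      rw [← Real.exp_add, hτ, Real.exp_zero]
    rw [← h1]
    exact mul_lt_mul (Real.exp_lt_exp.2 (by linarith)) (by linarith) (by linarith)
      (Real.exp_pos _).le
  obtain ⟨q, hq1, hq2⟩ := exists_between hlt
  have hq0 : 0 < q :=
    (mul_pos (Real.exp_pos _) (by linarith)).trans hq1
  have hqp : Tendsto (fun p : ℝ => p * x * q ^ p) atTop (nhds 0) := by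
    have := (tendsto_rpow_mul_exp_neg_mul_atTop_nhds_zero 1 (-Real.log q)
      (neg_pos.2 (Real.log_neg hq0 hq2))).const_mul x
    simp only [mul_zero, Real.rpow_one, neg_neg] at this
    refine this.congr fun p => ?_
    rw [Real.rpow_def_of_pos hq0]
    ring
  have hWlim : Tendsto (fun p => (E p (a p) - p * x * q ^ p) * (x - a p / p)) atTop
      (nhds ((4 - 0) * (x - 1 / 4))) := (h.slope.sub hqp).mul (h.left.const_sub x)
  filter_upwards [h.profile, h.slope_le, hlim.eventually_lt_const hq1, eventually_gt_atTop 0,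
    h.left.eventually_lt_const hx0, h.left.eventually_const_lt (show (0 : ℝ) < 1 / 4 by norm_num),
    h.slope.eventually_const_lt (show (3 : ℝ) < 4 by norm_num),
    hqp.eventually_lt_const hδ, hqp.eventually_lt_const one_pos,
    hWlim.eventually_const_lt (show τ - 5 * δ < (4 - 0) * (x - 1 / 4) by linarith)]
    with p hO hE hq hp hax ha0 hE3 hqδ hq1 hWp
  have hpx : p * x / p = x := by field_simp
  have hap : a p ≤ p * x := by
    rw [div_lt_iff₀ hp] at hax
    linarith
  have hap0 : 0 < a p := by
    rw [lt_div_iff₀ hp] at ha0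
    linarith
  have hqp0 : 0 < q ^ p := Real.rpow_pos_of_pos hq0 p
  have hq' : Real.exp (2 * (p * x / p)) * (4 * (p * x / p - a p / p)) ≤ q := by
    rw [hpx]; exact hq.le
  have hslope : ∀ s, a p ≤ s → s ≤ b p → s ≤ p * x → E p (a p) - p * x * q ^ p ≤ E p s := by
    intro s h1 h2 h3
    have := hO.slope_ge hp hE h1 h2 h3 hq'
    nlinarith
  have hm : p * x < m p := by
    by_contra! hcon
    have := hslope (m p) hO.left_lt.le hO.lt_right.le hcon
    rw [hO.crit] at this
    linarith
  have hs := hslope (p * x) hap (hm.trans hO.lt_right).le le_rfl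
  refine ⟨hm, hap, ?_, by linarith⟩
  have h1 := hO.add_right_slope_le hp le_rfl hap (hm.trans hO.lt_right).le
  rw [hO.left_zero, zero_add] at h1
  refine hWp.le.trans ?_
  rw [le_div_iff₀ hp]
  have h2 : (E p (a p) - p * x * q ^ p) * (x - a p / p) * p
      = (E p (a p) - p * x * q ^ p) * (p * x - a p) := by
    field_simp
  rw [h2]
  nlinarith

theorem eventually_lt_max (h : Family a m b W E) (h0 : 0 < τ)
    (hτ : (1 + τ) / 2 + Real.log τ = 0) {l : ℝ} (hl : l < τ) :
    ∀ᶠ p in atTop, l < W p (m p) / p := by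
  have hδ : 0 < min (τ / 8) ((τ - l) / 10) := lt_min (by linarith) (by linarith)
  filter_upwards [h.profile, h.early h0 hτ hδ ((min_le_left _ _).trans_lt (by linarith)),
    eventually_gt_atTop 0] with p hO hp2 hp
  obtain ⟨h1, h2, h3, -⟩ := hp2
  have h4 := div_le_div_of_nonneg_right (hO.W_mono hp h2 h1.le le_rfl) hp.le
  linarith [min_le_right (τ / 8) ((τ - l) / 10)]

theorem force_max_bound (h : Family a m b W E) (h0 : 0 < τ)
    (hτ : (1 + τ) / 2 + Real.log τ = 0) :
    ∀ᶠ p in atTop, force p (m p) (W p (m p)) ≤ 16 * (1 + 2 / τ) := by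
  filter_upwards [h.profile, h.slope_le, eventually_gt_atTop 1,
    h.eventually_lt_max h0 hτ (show τ / 2 < τ by linarith)] with p hO hE hp hμ
  have hp0 : 0 < p := by linarith
  set μ := W p (m p) / p with hμd
  have hWm : W p (m p) = μ * p := by rw [hμd]; field_simp
  have hμ0 : 0 < μ := by linarith
  have hE0 := hO.left_slope_nonneg hp0
  have h1 := hO.force_max_le hp0
  have hf0 := force_nonneg (s := m p) hp0 hO.max_pos.le
  rw [hWm] at h1 hf0 ⊢
  set f := force p (m p) (μ * p) with hf
  have h2 : f * (μ * p) ≤ (p + 1) * (E p (a p) ^ 2 / 2) + 2 * (μ * p) * E p (a p) := by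
    rw [div_le_iff₀ (by linarith)] at h1
    have : (E p (a p) ^ 2 / 2 + 2 * (μ * p) / (p + 1) * E p (a p)) * (p + 1)
      = (p + 1) * (E p (a p) ^ 2 / 2) + 2 * (μ * p) * E p (a p) := by field_simp
    linarith
  have h3 : f * μ ≤ 16 * (1 + μ) := by
    have h4 : E p (a p) ^ 2 / 2 ≤ 8 := by nlinarith
    have h5 : (p + 1) * (E p (a p) ^ 2 / 2) ≤ (2 * p) * 8 :=
      mul_le_mul (by linarith) h4 (by positivity) (by linarith)
    have h6 : 2 * (μ * p) * E p (a p) ≤ 2 * (μ * p) * 4 :=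
      mul_le_mul_of_nonneg_left hE (by positivity)
    have h7 : f * μ * p ≤ 16 * (1 + μ) * p := by nlinarith
    exact le_of_mul_le_mul_right h7 hp0
  have h4 : f ≤ 16 * (1 + 1 / μ) := by
    have : 16 * (1 + 1 / μ) = 16 * (1 + μ) / μ := by
      field_simp
      ring
    rw [this, le_div_iff₀ hμ0]
    exact h3
  have h5 : 1 / μ ≤ 2 / τ := by
    rw [div_le_div_iff₀ hμ0 h0]
    linarith
  linarith

theorem log_max_bound (h : Family a m b W E) (h0 : 0 < τ)
    (hτ : (1 + τ) / 2 + Real.log τ = 0) :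
    ∀ᶠ p in atTop, 2 * (m p / p) + Real.log (W p (m p) / p) ≤ Real.log (16 * (1 + 2 / τ)) / p := by
  filter_upwards [h.profile, h.force_max_bound h0 hτ, eventually_gt_atTop 0] with p hO hf hp
  have hμ : 0 < W p (m p) / p := div_pos hO.max_pos hp
  rw [le_div_iff₀ hp]
  rw [force, Real.rpow_def_of_pos hμ, ← Real.exp_add] at hf
  have := (Real.le_log_iff_exp_le (by positivity)).2 hf
  have h2 : 2 * (m p / p) * p = 2 * m p := by field_simp
  linarith

theorem tendsto_max (h : Family a m b W E) (h0 : 0 < τ)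
    (hτ : (1 + τ) / 2 + Real.log τ = 0) :
    Tendsto (fun p => W p (m p) / p) atTop (nhds τ) := by
  refine tendsto_order.2 ⟨fun l hl => h.eventually_lt_max h0 hτ hl, fun u hu => ?_⟩
  have hlog : Real.log τ < Real.log u := Real.log_lt_log h0 hu
  have hδ : 0 < min (τ / 8) ((Real.log u - Real.log τ) / 4) := lt_min (by linarith) (by linarith)
  have hK : Tendsto (fun p : ℝ => Real.log (16 * (1 + 2 / τ)) / p) atTop (nhds 0) :=
    tendsto_const_nhds.div_atTop tendsto_id
  filter_upwards [h.profile, h.early h0 hτ hδ ((min_le_left _ _).trans_lt (by linarith)),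
    h.log_max_bound h0 hτ, hK.eventually_lt_const hδ, eventually_gt_atTop 0]
    with p hO hp2 hb hk hp
  have hμ : 0 < W p (m p) / p := div_pos hO.max_pos hp
  refine (Real.log_lt_log_iff hμ (h0.trans hu)).1 ?_
  have h1 : (1 + τ) / 4 - min (τ / 8) ((Real.log u - Real.log τ) / 4) < m p / p := by
    rw [lt_div_iff₀ hp]
    linarith [hp2.1]
  linarith [min_le_right (τ / 8) ((Real.log u - Real.log τ) / 4)]

theorem tendsto_crit (h : Family a m b W E) (h0 : 0 < τ)
    (hτ : (1 + τ) / 2 + Real.log τ = 0) :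
    Tendsto (fun p => m p / p) atTop (nhds ((1 + τ) / 4)) := by
  have hK : Tendsto (fun p : ℝ => Real.log (16 * (1 + 2 / τ)) / p) atTop (nhds 0) :=
    tendsto_const_nhds.div_atTop tendsto_id
  have hlim := (hK.sub ((h.tendsto_max h0 hτ).log h0.ne')).div_const 2
  refine tendsto_order.2 ⟨fun l hl => ?_, fun u hu => ?_⟩
  · have hδ : 0 < min (τ / 8) ((1 + τ) / 4 - l) := lt_min (by linarith) (by linarith)
    filter_upwards [h.early h0 hτ hδ ((min_le_left _ _).trans_lt (by linarith)),
      eventually_gt_atTop 0] with p hp2 hp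
    rw [lt_div_iff₀ hp]
    have := hp2.1
    nlinarith [min_le_right (τ / 8) ((1 + τ) / 4 - l)]
  · filter_upwards [h.log_max_bound h0 hτ, hlim.eventually_lt_const (u := u) (by linarith)]
      with p h1 h2
    linarith

theorem right_slope_upper (h : Family a m b W E) :
    ∀ᶠ p in atTop, -E p (b p) ≤ E p (a p) + 4 * (W p (m p) / p) := by
  filter_upwards [h.profile, eventually_gt_atTop 0] with p hO hp
  refine (hO.right_slope_le hp).trans ?_
  have : W p (m p) / (p + 1) ≤ W p (m p) / p :=
    div_le_div_of_nonneg_left hO.max_pos.le hp (by linarith)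
  have h2 : 4 * W p (m p) / (p + 1) = 4 * (W p (m p) / (p + 1)) := by ring
  linarith

theorem right_slope_le_eight (h : Family a m b W E) (h0 : 0 < τ) (h1 : τ < 1)
    (hτ : (1 + τ) / 2 + Real.log τ = 0) : ∀ᶠ p in atTop, -E p (b p) ≤ 8 := by
  filter_upwards [h.right_slope_upper, h.slope_le,
    (h.tendsto_max h0 hτ).eventually_lt_const h1] with p h2 h3 h4
  linarith

theorem crit_add_sqrt_le (h : Family a m b W E) (h0 : 0 < τ) (h1 : τ < 1)
    (hτ : (1 + τ) / 2 + Real.log τ = 0) : ∀ᶠ p in atTop, m p + √p ≤ b p := by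
  filter_upwards [h.profile, h.right_slope_le_eight h0 h1 hτ, eventually_gt_atTop 0,
    h.eventually_lt_max h0 hτ (show τ / 2 < τ by linarith),
    tendsto_sqrt_div_self.eventually_lt_const (show (0 : ℝ) < τ / 16 by linarith)]
    with p hO h2 hp hμ hs
  have h3 := hO.mul_right_slope_ge hp
  rw [lt_div_iff₀ hp] at hμ
  rw [div_lt_iff₀ hp] at hs
  have h4 := hO.lt_right
  nlinarith

/-- The slope at `m + √p` agrees with the slope at the right end up to an error tending to `0`. -/
theorem slope_crit_add_sqrt (h : Family a m b W E) (h0 : 0 < τ) (h1 : τ < 1)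
    (hτ : (1 + τ) / 2 + Real.log τ = 0) :
    ∀ᶠ p in atTop, E p (m p + √p) ≤ E p (b p) + 16 * (1 + 2 / τ) * Real.exp (6 - √p) := by
  filter_upwards [h.profile, h.crit_add_sqrt_le h0 h1 hτ, h.force_max_bound h0 hτ,
    eventually_gt_atTop 4, (h.tendsto_max h0 hτ).eventually_lt_const h1,
    h.slope.eventually_const_lt (show (7 / 2 : ℝ) < 4 by norm_num)] with p hO hb hf hp hμ hE
  have hp0 : 0 < p := by linarith
  rw [div_lt_iff₀ hp0] at hμ
  have h2 : 2 ≤ √p := Real.le_sqrt_of_sq_le (by linarith)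
  have h3 := hO.slope_le_right hp0 hE.le (by linarith) (s := m p + √p) (by linarith) hb
  have h4 : 6 + m p - (m p + √p) = 6 - √p := by ring
  rw [h4] at h3
  have := mul_le_mul_of_nonneg_right hf (Real.exp_pos (6 - √p)).le
  linarith

theorem tendsto_error (τ : ℝ) :
    Tendsto (fun p : ℝ => 16 * (1 + 2 / τ) * Real.exp (6 - √p)) atTop (nhds 0) := by
  simpa using (tendsto_exp_const_sub_sqrt 6).const_mul (16 * (1 + 2 / τ))

theorem right_slope_lower (h : Family a m b W E) (h0 : 0 < τ) (h1 : τ < 1)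
    (hτ : (1 + τ) / 2 + Real.log τ = 0) {δ : ℝ} (hδ : 0 < δ) (hδτ : δ < τ / 8) :
    ∀ᶠ p in atTop,
      E p (a p) + 4 * (τ - 6 * δ) * (1 - δ) * (p / (p + 1)) ≤ -E p (b p) := by
  filter_upwards [h.profile, h.early h0 hτ hδ (by linarith), h.crit_add_sqrt_le h0 h1 hτ,
    h.slope_crit_add_sqrt h0 h1 hτ, (tendsto_error τ).eventually_lt_const hδ,
    h.right_slope_le_eight h0 h1 hτ, h.eventually_lt_max h0 hτ (show τ - δ < τ by linarith),
    tendsto_sqrt_div_self.eventually_lt_const (show (0 : ℝ) < δ / 8 by linarith),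
    eventually_gt_atTop 0, h.slope.eventually_const_lt (show (7 / 2 : ℝ) < 4 by norm_num)]
    with p hO he hb hs herr hE8 hμ hsq hp hE
  obtain ⟨e1, e2, e3, e4⟩ := he
  set x := p * ((1 + τ) / 4 - δ)
  set y := m p + √p with hy
  have hsqrt : 0 ≤ √p := Real.sqrt_nonneg p
  have hmy : m p ≤ y := by linarith
  rw [lt_div_iff₀ hp] at hμ
  rw [div_lt_iff₀ hp] at hsq
  rw [le_div_iff₀ hp] at e3
  have hWy : p * (τ - 6 * δ) ≤ W p y := by
    have h2 := hO.add_right_slope_le hp hO.left_lt.le hmy hb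
    have h3 := hO.E_antitone hp (hO.left_lt.le.trans hmy) hb le_rfl
    have h4 : y - m p = √p := by rw [hy]; ring
    rw [h4] at h2
    nlinarith
  have hK : ∀ s ∈ Ioo x y, p * (τ - 6 * δ) ≤ W p s := by
    intro s hs
    rcases le_total s (m p) with hsm | hsm
    · have := hO.W_mono hp e2 hs.1.le hsm
      nlinarith
    · exact hWy.trans (hO.W_anti hp hsm hs.2.le hb)
  have h2 := hO.le_energy_add hp e2 (e1.le.trans hmy) hb hK
  have h3 := hO.energy_mono hp (e2.trans (e1.le.trans hmy)) hb le_rfl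
  have h4 := hO.energy_mono hp le_rfl e2 (e1.le.trans (hmy.trans hb))
  rw [hO.energy_right] at h3
  rw [hO.energy_left] at h4
  have h5 := hO.right_slope_neg hp
  have h6 : 2 * (p * (τ - 6 * δ)) / (p + 1) = 2 * (τ - 6 * δ) * (p / (p + 1)) := by ring
  rw [h6] at h2
  have hk : 0 < 2 * (τ - 6 * δ) * (p / (p + 1)) := by
    have : 0 < τ - 6 * δ := by linarith
    positivity
  have h7 : E p (a p) + 4 * (τ - 6 * δ) * (1 - δ) * (p / (p + 1))
      = E p (a p) + 2 * (1 - δ) * (2 * (τ - 6 * δ) * (p / (p + 1))) := by ring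
  rw [h7]
  set k := 2 * (τ - 6 * δ) * (p / (p + 1))
  set c := E p (a p)
  set d := -E p (b p) with hd
  have hd' : E p (b p) = -d := by rw [hd, neg_neg]
  rw [hd'] at h3 h5 hs
  have h8 : k * (c + d - 2 * δ) ≤ d ^ 2 / 2 - c ^ 2 / 2 := by
    have := mul_le_mul_of_nonneg_left (show c + d - 2 * δ ≤ E p x - E p y by linarith) hk.le
    linarith
  have h9 : k * ((c + d) * (1 - δ)) ≤ k * (c + d - 2 * δ) :=
    mul_le_mul_of_nonneg_left (by nlinarith) hk.le
  have h10 : (c + d) * (2 * (1 - δ) * k) ≤ (c + d) * (d - c) := by nlinarith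
  have := le_of_mul_le_mul_left h10 (by linarith)
  linarith

theorem tendsto_right_slope (h : Family a m b W E) (h0 : 0 < τ) (h1 : τ < 1)
    (hτ : (1 + τ) / 2 + Real.log τ = 0) :
    Tendsto (fun p => -E p (b p)) atTop (nhds (4 + 4 * τ)) := by
  have hp1 : Tendsto (fun p : ℝ => p / (p + 1)) atTop (nhds 1) := by
    have h2 : Tendsto (fun p : ℝ => 1 - 1 / (p + 1)) atTop (nhds (1 - 0)) :=
      (tendsto_const_nhds.div_atTop (tendsto_atTop_add_const_right _ 1 tendsto_id)).const_sub 1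
    rw [sub_zero] at h2
    refine h2.congr' ?_
    filter_upwards [eventually_gt_atTop 0] with p hp
    field_simp
    ring
  refine tendsto_order.2 ⟨fun l hl => ?_, fun u hu => ?_⟩
  · set δ := min (τ / 16) ((4 + 4 * τ - l) / 56) with hδd
    have hδ : 0 < δ := lt_min (by linarith) (by linarith)
    have hδ1 : δ ≤ τ / 16 := min_le_left _ _
    have hδ2 : δ ≤ (4 + 4 * τ - l) / 56 := min_le_right _ _
    have hlim : Tendsto (fun p => E p (a p) + 4 * (τ - 6 * δ) * (1 - δ) * (p / (p + 1))) atTop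
        (nhds (4 + 4 * (τ - 6 * δ) * (1 - δ) * 1)) := h.slope.add (hp1.const_mul _)
    filter_upwards [h.right_slope_lower h0 h1 hτ hδ (by linarith),
      hlim.eventually_const_lt (u := l) (by nlinarith)] with p h2 h3
    linarith
  · have hlim := h.slope.add ((h.tendsto_max h0 hτ).const_mul 4)
    filter_upwards [h.right_slope_upper, hlim.eventually_lt_const hu] with p h2 h3
    linarith

theorem tendsto_right (h : Family a m b W E) (h0 : 0 < τ) (h1 : τ < 1)
    (hτ : (1 + τ) / 2 + Real.log τ = 0) :
    Tendsto (fun p => b p / p) atTop (nhds ((1 + τ) / 4 + τ / (4 + 4 * τ))) := by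
  have hm := h.tendsto_crit h0 hτ
  have hμ := h.tendsto_max h0 hτ
  have hc := h.tendsto_right_slope h0 h1 hτ
  have hpos : 0 < 4 + 4 * τ := by linarith
  have hlow := hm.add (hμ.div hc hpos.ne')
  have hce := hc.sub (tendsto_error τ)
  rw [sub_zero] at hce
  have hup := (hm.add tendsto_sqrt_div_self).add (hμ.div hce hpos.ne')
  rw [add_zero] at hup
  refine tendsto_of_tendsto_of_tendsto_of_le_of_le' hlow hup ?_ ?_
  · filter_upwards [h.profile, eventually_gt_atTop 0] with p hO hp
    have h2 := hO.mul_right_slope_ge hp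
    have h3 : 0 < -E p (b p) := neg_pos.2 (hO.right_slope_neg hp)
    have h4 : W p (m p) / -E p (b p) ≤ b p - m p := by
      rw [div_le_iff₀ h3]
      linarith
    simp only [Pi.div_apply]
    rw [le_div_iff₀ hp]
    have h5 : (m p / p + W p (m p) / p / -E p (b p)) * p = m p + W p (m p) / -E p (b p) := by
      field_simp
    linarith
  · filter_upwards [h.profile, h.crit_add_sqrt_le h0 h1 hτ, h.slope_crit_add_sqrt h0 h1 hτ,
      hce.eventually_const_lt hpos, eventually_gt_atTop 0] with p hO hb hs hpos' hp
    have hsqrt : 0 ≤ √p := Real.sqrt_nonneg p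
    have h2 := hO.le_add_left_slope hp (x := m p + √p) (by linarith [hO.left_lt]) hb le_rfl
    rw [hO.right_zero] at h2
    have h3 := hO.W_le_max hp (s := m p + √p) (by linarith [hO.left_lt]) hb
    simp only [Pi.div_apply]
    set c := -E p (b p) - 16 * (1 + 2 / τ) * Real.exp (6 - √p)
    have h4 : b p - (m p + √p) ≤ W p (m p) / c := by
      rw [le_div_iff₀ hpos']
      nlinarith
    rw [div_le_iff₀ hp]
    have h5 : (m p / p + √p / p + W p (m p) / p / c) * p = m p + √p + W p (m p) / c := by
      field_simp
    linarith

end Family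

end OuterProfile

/-! ### Radial Lane–Emden solutions in logarithmic coordinates -/

namespace LaneEmdenFamily

variable (F : LaneEmdenFamily) (p : ℝ)

/-- The sup norm of the negative part. -/
def height : ℝ := -F.u p 0

/-- The radial derivative, one-sided at the end points of `[0, 1]`. -/
def du : ℝ → ℝ := derivWithin (F.u p) (Icc 0 1)

/-- The logarithmic coordinate of the boundary of the ball. -/
def logRadius : ℝ := (Real.log p + (p - 1) * Real.log (F.height p)) / 2

/-- The rescaled solution, in logarithmic coordinates. -/
def profile (s : ℝ) : ℝ := -(p / F.height p) * F.u p (Real.exp (s - F.logRadius p))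

/-- The derivative of the rescaled solution. -/
def profileDeriv (s : ℝ) : ℝ :=
  -(p / F.height p) * (Real.exp (s - F.logRadius p) * F.du p (Real.exp (s - F.logRadius p)))

variable {p}

theorem height_pos (hp : 1 < p) : 0 < F.height p := neg_pos.2 (F.center_neg p hp)

theorem continuousOn_u (hp : 1 < p) : ContinuousOn (F.u p) (Icc 0 1) :=
  (F.smooth p hp).continuousOn

theorem continuousOn_du (hp : 1 < p) : ContinuousOn (F.du p) (Icc 0 1) :=
  (F.smooth p hp).continuousOn_derivWithin (uniqueDiffOn_Icc zero_lt_one) (by norm_num)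

theorem contDiffAt_u (hp : 1 < p) {r : ℝ} (hr : r ∈ Ioo (0 : ℝ) 1) : ContDiffAt ℝ 2 (F.u p) r :=
  (F.smooth p hp).contDiffAt (Icc_mem_nhds hr.1 hr.2)

theorem du_eq_deriv {r : ℝ} (hr : r ∈ Ioo (0 : ℝ) 1) : F.du p r = deriv (F.u p) r :=
  derivWithin_of_mem_nhds (Icc_mem_nhds hr.1 hr.2)

theorem hasDerivAt_u (hp : 1 < p) {r : ℝ} (hr : r ∈ Ioo (0 : ℝ) 1) :
    HasDerivAt (F.u p) (F.du p r) r := by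
  rw [F.du_eq_deriv hr]
  exact ((F.contDiffAt_u hp hr).differentiableAt (by norm_num)).hasDerivAt

theorem hasDerivAt_du (hp : 1 < p) {r : ℝ} (hr : r ∈ Ioo (0 : ℝ) 1) :
    HasDerivAt (F.du p) (-(F.du p r / r) - |F.u p r| ^ (p - 1) * F.u p r) r := by
  have h1 : ContDiffAt ℝ 1 (deriv (F.u p)) r :=
    (F.contDiffAt_u hp hr).derivWithin (m := 1) (by norm_num)
  have h2 := (h1.differentiableAt (by norm_num)).hasDerivAt
  have h3 : F.du p =ᶠ[nhds r] deriv (F.u p) := by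
    filter_upwards [isOpen_Ioo.mem_nhds hr] with x hx using F.du_eq_deriv hx
  have h4 := F.ode p hp r hr
  refine (h2.congr_of_eventuallyEq h3).congr_deriv ?_
  rw [F.du_eq_deriv hr]
  linarith

theorem exp_sub_mem_Ioo {s : ℝ} (hs : s < F.logRadius p) :
    Real.exp (s - F.logRadius p) ∈ Ioo (0 : ℝ) 1 :=
  ⟨Real.exp_pos _, Real.exp_lt_one_iff.2 (by linarith)⟩

theorem exp_sub_mem_Icc {s : ℝ} (hs : s ≤ F.logRadius p) :
    Real.exp (s - F.logRadius p) ∈ Icc (0 : ℝ) 1 :=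
  ⟨(Real.exp_pos _).le, Real.exp_le_one_iff.2 (by linarith)⟩

theorem continuousOn_profile (hp : 1 < p) : ContinuousOn (F.profile p) (Iic (F.logRadius p)) :=
  ((F.continuousOn_u hp).comp (f := fun s => Real.exp (s - F.logRadius p)) (by fun_prop)
    (fun _ hs => F.exp_sub_mem_Icc hs)).const_mul _

theorem continuousOn_profileDeriv (hp : 1 < p) :
    ContinuousOn (F.profileDeriv p) (Iic (F.logRadius p)) := by
  have h1 : ContinuousOn (fun s => Real.exp (s - F.logRadius p)) (Iic (F.logRadius p)) := by
    fun_prop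
  exact (h1.mul ((F.continuousOn_du hp).comp h1 (fun _ hs => F.exp_sub_mem_Icc hs))).const_mul _

theorem hasDerivAt_exp_sub (c s : ℝ) :
    HasDerivAt (fun s : ℝ => Real.exp (s - c)) (Real.exp (s - c)) s := by
  simpa using ((hasDerivAt_id s).sub_const c).exp

theorem hasDerivAt_profile (hp : 1 < p) {s : ℝ} (hs : s < F.logRadius p) :
    HasDerivAt (F.profile p) (F.profileDeriv p s) s := by
  have := ((F.hasDerivAt_u hp (F.exp_sub_mem_Ioo hs)).comp s
    (hasDerivAt_exp_sub (F.logRadius p) s)).const_mul (-(p / F.height p))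
  refine this.congr_deriv ?_
  rw [profileDeriv]
  ring

theorem exp_two_mul_logRadius (hp : 1 < p) :
    Real.exp (2 * F.logRadius p) = p * F.height p ^ (p - 1) := by
  have h1 : 2 * F.logRadius p = Real.log p + Real.log (F.height p) * (p - 1) := by
    rw [logRadius]; ring
  rw [h1, Real.exp_add, Real.exp_log (by linarith), ← Real.rpow_def_of_pos (F.height_pos hp)]

theorem rescaled_force (hp : 1 < p) {s x : ℝ} (hx : 0 < x) :
    p / F.height p * (Real.exp (s - F.logRadius p) ^ 2 * x ^ p) =
      force p s (p / F.height p * x) := by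
  have hγ := F.height_pos hp
  have h1 : Real.exp (s - F.logRadius p) ^ 2 = Real.exp (2 * s) / (p * F.height p ^ (p - 1)) := by
    rw [← F.exp_two_mul_logRadius hp, ← Real.exp_sub, ← Real.exp_nat_mul]
    push_cast
    ring_nf
  have h2 : p / F.height p * x / p = x / F.height p := by field_simp
  have h3 := (Real.rpow_pos_of_pos hγ p).ne'
  rw [h1, force, h2, Real.div_rpow hx.le hγ.le, Real.rpow_sub_one hγ.ne']
  field_simp

theorem hasDerivAt_profileDeriv (hp : 1 < p) {s : ℝ} (hs : s < F.logRadius p) :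
    HasDerivAt (F.profileDeriv p) (p / F.height p * (Real.exp (s - F.logRadius p) ^ 2 *
      (|F.u p (Real.exp (s - F.logRadius p))| ^ (p - 1) *
        F.u p (Real.exp (s - F.logRadius p))))) s := by
  have he := hasDerivAt_exp_sub (F.logRadius p) s
  have := (he.mul ((F.hasDerivAt_du hp (F.exp_sub_mem_Ioo hs)).comp s he)).const_mul
    (-(p / F.height p))
  refine this.congr_deriv ?_
  have h0 := (Real.exp_pos (s - F.logRadius p)).ne'
  simp only [Function.comp_apply]
  field_simp
  ring

theorem hasDerivAt_profileDeriv_of_neg (hp : 1 < p) {s : ℝ} (hs : s < F.logRadius p)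
    (hneg : F.u p (Real.exp (s - F.logRadius p)) < 0) :
    HasDerivAt (F.profileDeriv p) (-force p s (F.profile p s)) s := by
  refine (F.hasDerivAt_profileDeriv hp hs).congr_deriv ?_
  have h1 : F.profile p s = p / F.height p * -F.u p (Real.exp (s - F.logRadius p)) := by
    rw [profile]; ring
  rw [h1, ← F.rescaled_force hp (neg_pos.2 hneg), abs_of_neg hneg,
    Real.rpow_sub_one (neg_pos.2 hneg).ne']
  have hu := hneg.ne
  have hγ := (F.height_pos hp).ne'
  field_simp

theorem hasDerivAt_profileDeriv_of_pos (hp : 1 < p) {s : ℝ} (hs : s < F.logRadius p)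
    (hpos : 0 < F.u p (Real.exp (s - F.logRadius p))) :
    HasDerivAt (F.profileDeriv p) (force p s (-F.profile p s)) s := by
  refine (F.hasDerivAt_profileDeriv hp hs).congr_deriv ?_
  have h1 : -F.profile p s = p / F.height p * F.u p (Real.exp (s - F.logRadius p)) := by
    rw [profile]; ring
  rw [h1, ← F.rescaled_force hp hpos, abs_of_pos hpos, Real.rpow_sub_one hpos.ne']
  field_simp

theorem tendsto_exp_sub :
    Tendsto (fun s => Real.exp (s - F.logRadius p)) atBot (nhdsWithin 0 (Icc 0 1)) := by
  refine tendsto_nhdsWithin_iff.2 ⟨?_, ?_⟩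
  · refine Real.tendsto_exp_atBot.comp ?_
    simpa [sub_eq_add_neg] using
      tendsto_atBot_add_const_right atBot (-F.logRadius p) tendsto_id
  · filter_upwards [eventually_le_atBot (F.logRadius p)] with s hs using F.exp_sub_mem_Icc hs

theorem innerProfile (hp : 1 < p) :
    InnerProfile p (F.logRadius p + Real.log (F.rp p)) (F.profile p) (F.profileDeriv p) := by
  have hγ := F.height_pos hp
  have hr := F.rp_mem p hp
  have hlt : F.logRadius p + Real.log (F.rp p) < F.logRadius p := by
    linarith [Real.log_neg hr.1 hr.2]
  have hneg : ∀ s < F.logRadius p + Real.log (F.rp p),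
      F.u p (Real.exp (s - F.logRadius p)) < 0 := fun s hs =>
    F.neg_in p hp _ ⟨(Real.exp_pos _).le, (Real.lt_log_iff_exp_lt hr.1).1 (by linarith)⟩
  have h0 : (0 : ℝ) ∈ Icc (0 : ℝ) 1 := left_mem_Icc.2 zero_le_one
  refine ⟨(F.continuousOn_profile hp).mono (Iic_subset_Iic.2 hlt.le),
    (F.continuousOn_profileDeriv hp).mono (Iic_subset_Iic.2 hlt.le),
    fun s hs => F.hasDerivAt_profile hp (hs.trans hlt),
    fun s hs => F.hasDerivAt_profileDeriv_of_neg hp (hs.trans hlt) (hneg s hs), ?_, ?_, ?_, ?_⟩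
  · have h1 : Tendsto (F.profile p) atBot (nhds (-(p / F.height p) * F.u p 0)) :=
      (((F.continuousOn_u hp) 0 h0).tendsto.comp F.tendsto_exp_sub).const_mul _
    have h2 : -(p / F.height p) * F.u p 0 = p := by
      have : F.u p 0 = -F.height p := by rw [height, neg_neg]
      rw [this]
      field_simp
    rwa [h2] at h1
  · have h1 : Tendsto (F.profileDeriv p) atBot
        (nhds (-(p / F.height p) * (0 * F.du p 0))) :=
      ((tendsto_nhdsWithin_iff.1 F.tendsto_exp_sub).1.mul
        (((F.continuousOn_du hp) 0 h0).tendsto.comp F.tendsto_exp_sub)).const_mul _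
    simpa using h1
  · intro s hs
    have h1 : 0 < p / F.height p := div_pos (by linarith) hγ
    rw [profile]
    nlinarith [hneg s hs]
  · rw [profile, add_sub_cancel_left, Real.exp_log hr.1, F.rp_zero p hp, mul_zero]

theorem du_sp (hp : 1 < p) : F.du p (F.sp p) = 0 := by
  have hr := F.rp_mem p hp
  have hs := F.sp_mem p hp
  refine IsLocalMax.hasDerivAt_eq_zero ?_ (F.hasDerivAt_u hp ⟨hr.1.trans hs.1, hs.2⟩)
  filter_upwards [Icc_mem_nhds (hr.1.trans hs.1) hs.2] with x hx using F.sp_max p hp x hx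

theorem outerProfile (hp : 1 < p) :
    OuterProfile p (F.logRadius p + Real.log (F.rp p)) (F.logRadius p + Real.log (F.sp p))
      (F.logRadius p) (fun s => -F.profile p s) (fun s => -F.profileDeriv p s) := by
  have hγ := F.height_pos hp
  have hr := F.rp_mem p hp
  have hs := F.sp_mem p hp
  have hs0 : 0 < F.sp p := hr.1.trans hs.1
  have hpos : ∀ s ∈ Ioo (F.logRadius p + Real.log (F.rp p)) (F.logRadius p),
      0 < F.u p (Real.exp (s - F.logRadius p)) := fun s hs =>
    F.pos_out p hp _ ⟨(Real.log_lt_iff_lt_exp hr.1).1 (by linarith [hs.1]),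
      (F.exp_sub_mem_Ioo hs.2).2⟩
  refine ⟨((F.continuousOn_profile hp).mono fun _ hx => hx.2).neg,
    ((F.continuousOn_profileDeriv hp).mono fun _ hx => hx.2).neg,
    fun s hs => (F.hasDerivAt_profile hp hs.2).neg,
    fun s hs => (F.hasDerivAt_profileDeriv_of_pos hp hs.2 (hpos s hs)).neg, ?_, ?_, ?_, ?_, ?_, ?_⟩
  · intro s hs
    have h1 : 0 < p / F.height p := div_pos (by linarith) hγ
    have := mul_pos h1 (hpos s hs)
    rw [profile]
    linarith
  · rw [(F.innerProfile hp).zero, neg_zero]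
  · rw [profile, sub_self, Real.exp_zero, F.boundary p hp, mul_zero, neg_zero]
  · rw [profileDeriv, add_sub_cancel_left, Real.exp_log hs0, F.du_sp hp, mul_zero, mul_zero,
      neg_zero]
  · linarith [Real.log_lt_log hr.1 hs.1]
  · linarith [Real.log_neg hs0 hs.2]

theorem outerFamily : OuterProfile.Family (fun p => F.logRadius p + Real.log (F.rp p))
    (fun p => F.logRadius p + Real.log (F.sp p)) F.logRadius (fun p s => -F.profile p s)
    (fun p s => -F.profileDeriv p s) := by
  have hI : ∀ᶠ p in atTop, InnerProfile p (F.logRadius p + Real.log (F.rp p)) (F.profile p)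
      (F.profileDeriv p) := by
    filter_upwards [eventually_gt_atTop 1] with p hp using F.innerProfile hp
  refine ⟨?_, ?_, ?_, InnerProfile.tendsto_zero_div hI⟩
  · filter_upwards [eventually_gt_atTop 1] with p hp using F.outerProfile hp
  · simpa using (InnerProfile.tendsto_slope hI).neg
  · filter_upwards [eventually_gt_atTop 1] with p hp
    linarith [(F.innerProfile hp).D_ge_neg_four (by linarith) le_rfl]

theorem tendsto_log_height {σ : ℝ} (h : Tendsto (fun p => F.logRadius p / p) atTop (nhds σ)) :
    Tendsto (fun p => Real.log (F.height p)) atTop (nhds (2 * σ)) := by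
  have hlog : Tendsto (fun p : ℝ => Real.log p / p) atTop (nhds 0) := by
    simpa using Real.tendsto_pow_log_div_mul_add_atTop 1 0 1 one_ne_zero
  have h1 : Tendsto (fun p : ℝ => (2 * (F.logRadius p / p) - Real.log p / p) / (1 - p⁻¹)) atTop
      (nhds ((2 * σ - 0) / (1 - 0))) :=
    ((h.const_mul 2).sub hlog).div (tendsto_inv_atTop_zero.const_sub 1) (by norm_num)
  rw [sub_zero, sub_zero, div_one] at h1
  refine h1.congr' ?_
  filter_upwards [eventually_gt_atTop 1] with p hp
  have h2 : p - 1 ≠ 0 := by linarith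
  have h3 : p ≠ 0 := by linarith
  rw [logRadius]
  field_simp
  ring

/-- The Pohozaev identity: the Dirichlet integral in terms of the boundary slope. -/
theorem integral_deriv_sq (hp : 1 < p) :
    ∫ r in (0 : ℝ)..1, deriv (F.u p) r ^ 2 * r = (p + 1) / 4 * F.du p 1 ^ 2 := by
  have hu := F.continuousOn_u hp
  have hdu := F.continuousOn_du hp
  have habs : ContinuousOn (fun r => |F.u p r| ^ (p + 1)) (Icc 0 1) :=
    hu.abs.rpow_const fun _ _ => Or.inr (by linarith)
  have hcongr : ∫ r in (0 : ℝ)..1, deriv (F.u p) r ^ 2 * r =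
      ∫ r in (0 : ℝ)..1, F.du p r ^ 2 * r := by
    rw [intervalIntegral.integral_of_le zero_le_one, intervalIntegral.integral_of_le zero_le_one,
      integral_Ioc_eq_integral_Ioo, integral_Ioc_eq_integral_Ioo]
    refine setIntegral_congr_fun measurableSet_Ioo fun r hr => ?_
    simp only [F.du_eq_deriv hr]
  rw [hcongr]
  have hint : IntervalIntegrable (fun r => F.du p r ^ 2 * r) volume 0 1 := by
    refine ContinuousOn.intervalIntegrable ?_
    rw [uIcc_of_le zero_le_one]
    fun_prop
  rw [intervalIntegral.integral_eq_sub_of_hasDerivAt_of_le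
    (f := fun r => (p + 1) / 4 * (r ^ 2 * F.du p r ^ 2) + 1 / 2 * (r ^ 2 * |F.u p r| ^ (p + 1))
      + r * F.u p r * F.du p r) zero_le_one (by fun_prop) ?_ hint]
  · rw [F.boundary p hp, abs_zero, Real.zero_rpow (by linarith)]
    norm_num
  · intro r hr
    have hr0 : r ≠ 0 := hr.1.ne'
    have h1 := F.hasDerivAt_u hp hr
    have h2 := F.hasDerivAt_du hp hr
    have h3 := (hasDerivAt_abs_rpow (F.u p r) (show 1 < p + 1 by linarith)).comp r h1
    have hsq := (hasDerivAt_id r).pow 2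
    have h4 := (((hsq.mul (h2.pow 2)).const_mul ((p + 1) / 4)).add
      ((hsq.mul h3).const_mul (1 / 2))).add (((hasDerivAt_id r).mul h1).mul h2)
    refine h4.congr_deriv ?_
    have h5 : |F.u p r| ^ (p + 1) = |F.u p r| ^ (p - 1) * F.u p r ^ 2 := by
      rcases eq_or_ne (F.u p r) 0 with h0 | h0
      · rw [h0, abs_zero, Real.zero_rpow (by linarith)]
        ring
      · rw [← sq_abs (F.u p r), ← Real.rpow_natCast, ← Real.rpow_add (abs_pos.2 h0)]
        norm_num
        ring_nf
    have h6 : p + 1 - 2 = p - 1 := by ring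
    simp only [Function.comp_apply, Pi.mul_apply, Pi.pow_apply, id, h5, h6]
    field_simp
    norm_num
    ring

end LaneEmdenFamily

/-! ### The limit constants -/

theorem existsUnique_root : ∃! t : ℝ, 0 < t ∧ 2 * √(Real.exp 1) * Real.log t + t = 0 := by
  have he : 1 < √(Real.exp 1) := Real.lt_sqrt_of_sq_lt (by linarith [Real.exp_one_gt_d9])
  have hmono : StrictMonoOn (fun t : ℝ => 2 * √(Real.exp 1) * Real.log t + t) (Ioi 0) := by
    intro x hx y hy hxy
    have h1 := Real.log_lt_log hx hxy
    show 2 * √(Real.exp 1) * Real.log x + x < 2 * √(Real.exp 1) * Real.log y + y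
    nlinarith
  have hlt : Real.exp (-1) < 1 := Real.exp_lt_one_iff.2 (by norm_num)
  have hcont : ContinuousOn (fun t : ℝ => 2 * √(Real.exp 1) * Real.log t + t)
      (Icc (Real.exp (-1)) 1) := by
    refine ContinuousOn.add (ContinuousOn.mul continuousOn_const ?_) continuousOn_id
    exact Real.continuousOn_log.mono fun x hx => ((Real.exp_pos _).trans_le hx.1).ne'
  obtain ⟨t, ht, ht0⟩ := intermediate_value_Icc hlt.le hcont
    (show (0 : ℝ) ∈ Icc _ _ by
      simp only [Real.log_exp, Real.log_one, mem_Icc]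
      constructor <;> linarith)
  have htpos : 0 < t := (Real.exp_pos _).trans_le ht.1
  exact ⟨t, ⟨htpos, ht0⟩, fun y hy => hmono.injOn hy.1 htpos (hy.2.trans ht0.symm)⟩

/-- As `p → +∞`: `‖u_p⁻‖_∞ → (√e/t̄)·e^{t̄/(2(t̄+√e))}`,
`‖u_p⁺‖_∞ → e^{t̄/(2(t̄+√e))}`, and `p·∫_B |∇u_p|² → 8π·e^{t̄/(t̄+√e)}·(e/t̄² + 1 + 2√e/t̄)`,
where `t̄` is the unique positive root of `2√e·log t + t = 0`
(here `‖u_p⁻‖_∞ = −u_p(0)`, `‖u_p⁺‖_∞ = u_p(s_p)`, and the Dirichlet integral over `B`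
is written in polar coordinates). -/
theorem sup_norms_and_energy_limits (F : LaneEmdenFamily) :
    (∃! t : ℝ, 0 < t ∧ 2 * Real.sqrt (Real.exp 1) * Real.log t + t = 0) ∧
    ∀ t : ℝ, 0 < t → 2 * Real.sqrt (Real.exp 1) * Real.log t + t = 0 →
      Tendsto (fun p => -F.u p 0) atTop
        (nhds (Real.sqrt (Real.exp 1) / t *
          Real.exp (t / (2 * (t + Real.sqrt (Real.exp 1)))))) ∧
      Tendsto (fun p => F.u p (F.sp p)) atTop
        (nhds (Real.exp (t / (2 * (t + Real.sqrt (Real.exp 1)))))) ∧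
      Tendsto (fun p => p * (2 * π * ∫ r in (0:ℝ)..1, (deriv (F.u p) r) ^ 2 * r)) atTop
        (nhds (8 * π * Real.exp (t / (t + Real.sqrt (Real.exp 1))) *
          (Real.exp 1 / t ^ 2 + 1 + 2 * Real.sqrt (Real.exp 1) / t))) := by
  refine ⟨existsUnique_root, fun t ht hroot => ?_⟩
  set e := √(Real.exp 1) with he
  have he0 : 0 < e := Real.sqrt_pos.2 (Real.exp_pos 1)
  have he2 : Real.exp 1 = e ^ 2 := (Real.sq_sqrt (Real.exp_pos 1).le).symm
  have hloge : Real.log e = 1 / 2 := by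
    rw [he, Real.log_sqrt (Real.exp_pos 1).le, Real.log_exp]
  obtain ⟨τ, rfl⟩ : ∃ τ, t = τ * e := ⟨t / e, by field_simp⟩
  have h0 : 0 < τ := pos_of_mul_pos_left ht he0.le
  have hτ : (1 + τ) / 2 + Real.log τ = 0 := by
    rw [Real.log_mul h0.ne' he0.ne', hloge] at hroot
    have : 2 * e * ((1 + τ) / 2 + Real.log τ) = 0 := by linarith
    exact (mul_eq_zero.1 this).resolve_left (by positivity)
  have h1 : τ < 1 := (Real.log_neg_iff h0).1 (by linarith)
  have hF := F.outerFamily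
  have hμ := hF.tendsto_max h0 hτ
  have hslope := hF.tendsto_right_slope h0 h1 hτ
  have hheight : Tendsto F.height atTop (nhds (τ⁻¹ * Real.exp (τ / (2 * (τ + 1))))) := by
    have h2 := (Real.continuous_exp.tendsto _).comp
      (F.tendsto_log_height (hF.tendsto_right h0 h1 hτ))
    have h3 : Real.exp (2 * ((1 + τ) / 4 + τ / (4 + 4 * τ))) =
        τ⁻¹ * Real.exp (τ / (2 * (τ + 1))) := by
      rw [← Real.exp_log (inv_pos.2 h0), Real.log_inv, ← Real.exp_add]
      congr 1
      have : Real.log τ = -((1 + τ) / 2) := by linarith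
      rw [this]
      field_simp
      ring
    rw [h3] at h2
    refine h2.congr' ?_
    filter_upwards [eventually_gt_atTop 1] with p hp using Real.exp_log (F.height_pos hp)
  have harg : τ * e / (2 * (τ * e + e)) = τ / (2 * (τ + 1)) := by field_simp
  rw [harg]
  refine ⟨?_, ?_, ?_⟩
  · have : e / (τ * e) = τ⁻¹ := by field_simp
    rw [this]
    exact hheight
  · have h2 := hμ.mul hheight
    rw [← mul_assoc, mul_inv_cancel₀ h0.ne', one_mul] at h2
    refine h2.congr' ?_
    filter_upwards [eventually_gt_atTop 1] with p hp
    have hs := F.sp_mem p hp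
    have hγ := F.height_pos hp
    rw [LaneEmdenFamily.profile, add_sub_cancel_left,
      Real.exp_log ((F.rp_mem p hp).1.trans hs.1)]
    field_simp
  · have hp1 : Tendsto (fun p : ℝ => 1 + p⁻¹) atTop (nhds (1 + 0)) :=
      tendsto_inv_atTop_zero.const_add 1
    have h2 := ((hp1.mul ((hheight.pow 2).mul (hslope.pow 2))).const_mul (π / 2))
    have h3 : π / 2 * ((1 + 0) * ((τ⁻¹ * Real.exp (τ / (2 * (τ + 1)))) ^ 2 * (4 + 4 * τ) ^ 2)) =
        8 * π * Real.exp (τ * e / (τ * e + e)) *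
          (Real.exp 1 / (τ * e) ^ 2 + 1 + 2 * e / (τ * e)) := by
      have h4 : Real.exp (τ * e / (τ * e + e)) = Real.exp (τ / (2 * (τ + 1))) ^ 2 := by
        rw [← Real.exp_nat_mul]
        congr 1
        push_cast
        field_simp
      rw [h4, he2]
      field_simp
      ring
    rw [h3] at h2
    refine h2.congr' ?_
    filter_upwards [eventually_gt_atTop 1] with p hp
    have hγ := F.height_pos hp
    rw [F.integral_deriv_sq hp, LaneEmdenFamily.profileDeriv, sub_self, Real.exp_zero]
    field_simp
    ring
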